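/- Let f be a multicritical circle map with irrational rotation number and let c₀ be a fixed critical point of f. There exist constants K = K(f) > 1 and n₀ = n₀(f) ∈ ℕ such that for all n > n₀, all x ∈ I_n, and all j ∈ {0, 1, …, q_{n+1}}, one has Df^j(x) ≤ K |f^j(I_n)| / |I_n|. -/

import Mathlib

open Set Filter Topology
open scoped ENNReal

noncomputable section

namespace MCircle

/-- A lift of an orientation-preserving `C³` circle homeomorphism of `S¹ = ℝ/ℤ`:
a `C³`, strictly increasing map commuting with the unit translation. -/
structure IsCircleMapLift (f : ℝ → ℝ) : Prop where
  smooth : ContDiff ℝ 3 f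
  mono : StrictMono f
  periodic : ∀ x : ℝ, f (x + 1) = f x + 1

/-- `c` is a non-flat (power-law) critical point of `f` of criticality `d > 1`:
near `c` we have `f x = f c + φ x * |φ x| ^ (d - 1)` for a `C³` diffeomorphism `φ`
of a neighbourhood `W` of `c` with `φ c = 0`. -/
def IsNonFlatCritPt (f : ℝ → ℝ) (c d : ℝ) : Prop :=
  1 < d ∧ ∃ (W : Set ℝ) (φ : ℝ → ℝ), IsOpen W ∧ c ∈ W ∧
    ContDiffOn ℝ 3 φ W ∧ φ c = 0 ∧ (∀ x ∈ W, deriv φ x ≠ 0) ∧ InjOn φ W ∧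
    ∀ x ∈ W, f x = f c + φ x * |φ x| ^ (d - 1)

/-- `f` is (a lift of) a multicritical circle map: the set of critical points of the
induced circle map, represented in `[0,1)`, is the nonempty finite set `C`, and each
critical point `c ∈ C` is non-flat of criticality `dc c`. -/
def IsMulticriticalLift (f : ℝ → ℝ) (C : Finset ℝ) (dc : ℝ → ℝ) : Prop :=
  IsCircleMapLift f ∧ C.Nonempty ∧ (↑C : Set ℝ) ⊆ Ico (0 : ℝ) 1 ∧
    (∀ x : ℝ, deriv f x = 0 ↔ ∃ c ∈ C, ∃ k : ℤ, x = c + (k : ℝ)) ∧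
    ∀ c ∈ C, IsNonFlatCritPt f c (dc c)

/-- The lift `f` has (translation) rotation number `ρ`. -/
def HasRotNumber (f : ℝ → ℝ) (ρ : ℝ) : Prop :=
  Tendsto (fun n : ℕ => f^[n] 0 / (n : ℝ)) atTop (𝓝 ρ)

/-- `f` is (a lift of) a multicritical circle map with critical set `C` (criticalities
`dc`) and irrational rotation number `ρ`, the lift being normalized so that `ρ ∈ (0,1)`. -/
def GoodMap (f : ℝ → ℝ) (C : Finset ℝ) (dc : ℝ → ℝ) (ρ : ℝ) : Prop :=
  IsMulticriticalLift f C dc ∧ HasRotNumber f ρ ∧ Irrational ρ ∧ ρ ∈ Ioo (0 : ℝ) 1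

/-- The Gauss map. -/
def gaussMap (x : ℝ) : ℝ := Int.fract x⁻¹

/-- The partial quotients `aₙ` of the continued fraction expansion
`ρ = [a₀, a₁, …] = 1/(a₀ + 1/(a₁ + ⋯))`. -/
def cfA (ρ : ℝ) (n : ℕ) : ℕ := ⌊(gaussMap^[n] (Int.fract ρ))⁻¹⌋₊

/-- The denominators `qₙ` of the convergents of `ρ` (the return times):
`q₀ = 1`, `q₁ = a₀`, `q_{n+2} = a_{n+1} q_{n+1} + qₙ`. -/
def qden (ρ : ℝ) : ℕ → ℕ
  | 0 => 1
  | 1 => cfA ρ 0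
  | n + 2 => cfA ρ (n + 1) * qden ρ (n + 1) + qden ρ n

/-- The numerators `pₙ` of the convergents of `ρ`:
`p₀ = 0`, `p₁ = 1`, `p_{n+2} = a_{n+1} p_{n+1} + pₙ`. -/
def pnum (ρ : ℝ) : ℕ → ℕ
  | 0 => 0
  | 1 => 1
  | n + 2 => cfA ρ (n + 1) * pnum ρ (n + 1) + pnum ρ n

/-- The lift representative of the `n`-th closest return `f^{qₙ}(x)`,
normalized (by the integer `pₙ`) to lie at distance less than one from `x`. -/
def retPt (f : ℝ → ℝ) (ρ x : ℝ) (n : ℕ) : ℝ := f^[qden ρ n] x - (pnum ρ n : ℝ)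

/-- The arc `Iₙ(x)`, with endpoints `x` and `f^{qₙ}(x)` and containing `f^{q_{n+2}}(x)`,
realized as an interval in the lift. -/
def arcI (f : ℝ → ℝ) (ρ x : ℝ) (n : ℕ) : Set ℝ := uIcc x (retPt f ρ x n)

/-- The length `|Iₙ(x)|`. -/
def arcLen (f : ℝ → ℝ) (ρ x : ℝ) (n : ℕ) : ℝ := |retPt f ρ x n - x|

/-- The length `|f^j(Iₙ(x))|`. -/
def arcImgLen (f : ℝ → ℝ) (ρ x : ℝ) (n j : ℕ) : ℝ :=
  |f^[j] (retPt f ρ x n) - f^[j] x|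

/-- Indices for the atoms of the `n`-th dynamical partition
`𝒫ₙ(x) = {fⁱ(Iₙ(x)) : 0 ≤ i ≤ q_{n+1}-1} ∪ {f^j(I_{n+1}(x)) : 0 ≤ j ≤ qₙ-1}`. -/
abbrev AtomIdx (ρ : ℝ) (n : ℕ) : Type :=
  {i : ℕ // i < qden ρ (n + 1)} ⊕ {j : ℕ // j < qden ρ n}

/-- Left endpoint (in the lift) of an atom of `𝒫ₙ(x)`. -/
def atomL (f : ℝ → ℝ) (ρ x : ℝ) (n : ℕ) : AtomIdx ρ n → ℝ
  | Sum.inl i => min (f^[i.1] x) (f^[i.1] (retPt f ρ x n))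
  | Sum.inr j => min (f^[j.1] x) (f^[j.1] (retPt f ρ x (n + 1)))

/-- Right endpoint (in the lift) of an atom of `𝒫ₙ(x)`. -/
def atomR (f : ℝ → ℝ) (ρ x : ℝ) (n : ℕ) : AtomIdx ρ n → ℝ
  | Sum.inl i => max (f^[i.1] x) (f^[i.1] (retPt f ρ x n))
  | Sum.inr j => max (f^[j.1] x) (f^[j.1] (retPt f ρ x (n + 1)))

/-- Length of an atom of `𝒫ₙ(x)`. -/
def atomLen (f : ℝ → ℝ) (ρ x : ℝ) (n : ℕ) (A : AtomIdx ρ n) : ℝ :=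
  atomR f ρ x n A - atomL f ρ x n A

/-- Two lift points represent the same point of the circle `ℝ/ℤ`. -/
def SameCirclePt (a b : ℝ) : Prop := ∃ m : ℤ, a = b + (m : ℝ)

/-- Two atoms of `𝒫ₙ(x)` are adjacent: they are distinct and share an endpoint
on the circle. -/
def AdjacentAtoms (f : ℝ → ℝ) (ρ x : ℝ) (n : ℕ) (A B : AtomIdx ρ n) : Prop :=
  A ≠ B ∧ ∃ p ∈ ({atomL f ρ x n A, atomR f ρ x n A} : Set ℝ),
    ∃ q ∈ ({atomL f ρ x n B, atomR f ρ x n B} : Set ℝ), SameCirclePt p q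

/-- `A` is the left neighbour of `Δ` in `𝒫ₙ(x)`. -/
def IsLeftNbr (f : ℝ → ℝ) (ρ x : ℝ) (n : ℕ) (A Δ : AtomIdx ρ n) : Prop :=
  A ≠ Δ ∧ SameCirclePt (atomR f ρ x n A) (atomL f ρ x n Δ)

/-- `B` is the right neighbour of `Δ` in `𝒫ₙ(x)`. -/
def IsRightNbr (f : ℝ → ℝ) (ρ x : ℝ) (n : ℕ) (B Δ : AtomIdx ρ n) : Prop :=
  B ≠ Δ ∧ SameCirclePt (atomL f ρ x n B) (atomR f ρ x n Δ)

/-- The arc `f^j(Δ)` is contained (as a circle arc) in some element of `𝒫ₙ(x)`. -/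
def ImgInAtom (f : ℝ → ℝ) (ρ x : ℝ) (n j : ℕ) (Δ : AtomIdx ρ n) : Prop :=
  ∃ E : AtomIdx ρ n, ∃ m : ℤ,
    atomL f ρ x n E + (m : ℝ) ≤ f^[j] (atomL f ρ x n Δ) ∧
    f^[j] (atomR f ρ x n Δ) ≤ atomR f ρ x n E + (m : ℝ)

/-- An atom of `𝒫ₙ(x)` as a subset of the circle `ℝ/ℤ`. -/
def atomSetC (f : ℝ → ℝ) (ρ x : ℝ) (n : ℕ) (A : AtomIdx ρ n) : Set (AddCircle (1 : ℝ)) :=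
  (fun y : ℝ => (y : AddCircle (1 : ℝ))) '' Icc (atomL f ρ x n A) (atomR f ρ x n A)

/-- The interval `Tₙ = I_{n+1} ∪ Iₙ ∪ f^{qₙ}(Iₙ)`, realized in the lift. -/
def Tset (f : ℝ → ℝ) (ρ x : ℝ) (n : ℕ) : Set ℝ :=
  arcI f ρ x (n + 1) ∪ arcI f ρ x n ∪
    (fun z => f^[qden ρ n] z - (pnum ρ n : ℝ)) '' arcI f ρ x n

/-- `j` is a critical time: `f^j(Tₙ)` contains a critical point of `f` (mod 1). -/
def IsCritTime (f : ℝ → ℝ) (ρ x : ℝ) (C : Finset ℝ) (n j : ℕ) : Prop :=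
  ∃ c ∈ C, ∃ m : ℤ, c + (m : ℝ) ∈ f^[j] '' Tset f ρ x n

/-- The cross-ratio `[M,T] = |L||R|/(|L∪M||M∪R|)` of the configuration
`M = [b,c] ⋐ T = [a,d]` (so `L = [a,b]`, `R = [c,d]`). -/
def crossRatio (a b c d : ℝ) : ℝ := ((b - a) * (d - c)) / ((c - a) * (d - b))

/-- The cross-ratio distortion `CrD(g; M, T)` of `g` on the configuration
`M = [b,c] ⋐ T = [a,d]`. -/
def crD (g : ℝ → ℝ) (a b c d : ℝ) : ℝ :=
  crossRatio (g a) (g b) (g c) (g d) / crossRatio a b c d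

/-- The Schwarzian derivative `Sg = g'''/g' - (3/2)(g''/g')²`. -/
def schwarzian (g : ℝ → ℝ) (x : ℝ) : ℝ :=
  iteratedDeriv 3 g x / deriv g x - (3 / 2) * (iteratedDeriv 2 g x / deriv g x) ^ 2

/-- `g` is a diffeomorphism on `S` with distortion bounded by `K`. -/
def DiffeoWithDistortionLE (g : ℝ → ℝ) (S : Set ℝ) (K : ℝ) : Prop :=
  ContDiffOn ℝ 1 g S ∧ InjOn g S ∧ (∀ x ∈ S, deriv g x ≠ 0) ∧
    ∀ x ∈ S, ∀ y ∈ S, |deriv g x| ≤ K * |deriv g y|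

/-- `g` is a diffeomorphism on `S` with negative Schwarzian derivative. -/
def NegSchwarzDiffeoOn (g : ℝ → ℝ) (S : Set ℝ) : Prop :=
  ContDiffOn ℝ 3 g S ∧ InjOn g S ∧ ∀ x ∈ S, deriv g x ≠ 0 ∧ schwarzian g x < 0

/-- The local quasi-symmetric distortion
`σ_h(x) = lim_{δ→0} limsup_{|t|≤δ} |h(x+t)-h(x)|/|h(x)-h(x-t)|` of a circle
homeomorphism lift `h`, with values in `[0,∞]`. -/
def qsDistortion (h : ℝ → ℝ) (x : ℝ) : ℝ≥0∞ :=
  Filter.limsup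
    (fun t : ℝ => ENNReal.ofReal (|h (x + t) - h x| / |h x - h (x - t)|))
    (𝓝[≠] (0 : ℝ))

end MCircle

open MCircle

section LiftDynamics

variable {f : ℝ → ℝ}

theorem iterate_map_add_intCast (hper : ∀ x, f (x + 1) = f x + 1) (n : ℕ) (x : ℝ) (k : ℤ) :
    f^[n] (x + k) = f^[n] x + k := by
  have h1 : ∀ (x : ℝ) (k : ℕ), f (x + k) = f x + k := by
    intro x k
    induction k with
    | zero => simp
    | succ k ih =>
      push_cast
      rw [← add_assoc, hper, ih, add_assoc]
  have h2 : ∀ (x : ℝ) (k : ℤ), f (x + k) = f x + k := by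
    intro x k
    obtain ⟨m, rfl | rfl⟩ := k.eq_nat_or_neg
    · simpa using h1 x m
    · have := h1 (x + ((-(m : ℤ) : ℤ) : ℝ)) m
      push_cast at this ⊢
      rw [neg_add_cancel_right] at this
      linarith
  induction n generalizing x with
  | zero => simp
  | succ n ih => rw [Function.iterate_succ_apply, h2, ih, Function.iterate_succ_apply]

theorem iterate_map_sub_intCast (hper : ∀ x, f (x + 1) = f x + 1) (n : ℕ) (x : ℝ) (k : ℤ) :
    f^[n] (x - k) = f^[n] x - k := by
  have := iterate_map_add_intCast hper n x (-k)
  push_cast at this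
  simpa [sub_eq_add_neg] using this

theorem map_add_intCast_of_map_add_one {h : ℝ → ℝ} {D : ℝ} (hD : ∀ x, h (x + 1) = h x + D)
    (x : ℝ) (k : ℤ) : h (x + k) = h x + k * D := by
  have h1 : ∀ (x : ℝ) (k : ℕ), h (x + k) = h x + k * D := by
    intro x k
    induction k with
    | zero => simp
    | succ k ih =>
      push_cast
      rw [← add_assoc, hD, ih]
      ring
  obtain ⟨m, rfl | rfl⟩ := k.eq_nat_or_neg
  · simpa using h1 x m
  · have := h1 (x + ((-(m : ℤ) : ℤ) : ℝ)) m
    push_cast at this ⊢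
    rw [neg_add_cancel_right] at this
    linarith

theorem sum_range_shift_sub_comm (H : ℕ → ℝ) (m n : ℕ) :
    ∑ i ∈ Finset.range m, (H (i + n) - H i) = ∑ i ∈ Finset.range n, (H (i + m) - H i) := by
  have h1 := Finset.sum_range_add H m n
  have h2 := Finset.sum_range_add H n m
  rw [add_comm n m] at h2
  simp only [Finset.sum_sub_distrib]
  simp_rw [fun i => add_comm i m, fun i => add_comm i n]
  linarith

/-- The combinatorial data of two consecutive closest returns `F = f^q - p` (moving points to
the right) and `f^q' - p'` (moving points to the left). -/
structure ReturnPair (f : ℝ → ℝ) (q q' : ℕ) (p p' : ℤ) : Prop where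
  le : q ≤ q'
  det : (q : ℤ) * p' - q' * p = 1
  right : ∀ x, x < f^[q] x - p
  left : ∀ x, f^[q'] x - p' < x
  right_add : ∀ x, x < f^[q + q'] x - (p + p' : ℤ)

variable {q q' : ℕ} {p p' : ℤ} {h : ℝ → ℝ} {D : ℝ}

/-- The images of a fundamental interval `[a, F a]` under the first `q'` iterates have total
`h`-variation at most one period. -/
theorem ReturnPair.sum_le (hR : ReturnPair f q q' p p')
    (hper : ∀ x, f (x + 1) = f x + 1) (hh : Monotone h) (hD : ∀ x, h (x + 1) = h x + D) (a : ℝ) :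
    ∑ i ∈ Finset.range q', (h (f^[i] (f^[q] a - p)) - h (f^[i] a)) ≤ D := by
  have e1 : ∀ i, h (f^[i] (f^[q] a - p)) = h (f^[i + q] a) - p * D := by
    intro i
    rw [iterate_map_sub_intCast hper, ← Function.iterate_add_apply]
    have := map_add_intCast_of_map_add_one hD (f^[i + q] a) (-p)
    push_cast at this
    rw [← sub_eq_add_neg] at this
    rw [this]; ring
  have e2 : ∀ i, h (f^[i + q'] a) - h (f^[i] a) ≤ p' * D := by
    intro i
    have h1 := hR.left (f^[i] a)
    rw [← Function.iterate_add_apply, add_comm q' i] at h1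
    have h2 : f^[i + q'] a ≤ f^[i] a + p' := by linarith
    have h3 := hh h2
    rw [map_add_intCast_of_map_add_one hD] at h3
    linarith
  have e3 : ∑ i ∈ Finset.range q', (h (f^[i] (f^[q] a - p)) - h (f^[i] a))
      = ∑ i ∈ Finset.range q', (h (f^[i + q] a) - h (f^[i] a)) - q' * (p * D) := by
    simp only [e1, Finset.sum_sub_distrib, Finset.sum_const, Finset.card_range, nsmul_eq_mul]
    ring
  rw [e3, sum_range_shift_sub_comm (fun i => h (f^[i] a))]
  have e4 := Finset.sum_le_card_nsmul (Finset.range q)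
    (fun i => h (f^[i + q'] a) - h (f^[i] a)) (p' * D) (fun i _ => e2 i)
  simp only [Finset.card_range, nsmul_eq_mul] at e4
  have e5 : ((q : ℝ) * p' - q' * p) = 1 := by exact_mod_cast hR.det
  have e6 : (q : ℝ) * (p' * D) - q' * (p * D) = D := by
    linear_combination D * e5
  linarith

theorem ReturnPair.sum_le_two_mul (hR : ReturnPair f q q' p p') (hf : StrictMono f)
    (hper : ∀ x, f (x + 1) = f x + 1) (hh : Monotone h) (hD : ∀ x, h (x + 1) = h x + D)
    (a : ℝ) {N : ℕ} (hN : N ≤ 2 * q') :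
    ∑ i ∈ Finset.range N, (h (f^[i] (f^[q] a - p)) - h (f^[i] a)) ≤ 2 * D := by
  have h0 : ∑ i ∈ Finset.range N, (h (f^[i] (f^[q] a - p)) - h (f^[i] a)) ≤
      ∑ i ∈ Finset.range (q' + q'), (h (f^[i] (f^[q] a - p)) - h (f^[i] a)) := by
    refine Finset.sum_le_sum_of_subset_of_nonneg
      (Finset.range_subset_range.2 (by omega)) fun i _ _ => ?_
    exact sub_nonneg.2 (hh ((hf.iterate i).monotone (hR.right a).le))
  rw [Finset.sum_range_add] at h0
  have h1 := hR.sum_le hper hh hD a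
  have h2 := hR.sum_le hper hh hD (f^[q'] a)
  have h3 : ∀ i, h (f^[i] (f^[q] (f^[q'] a) - p)) - h (f^[i] (f^[q'] a)) =
      h (f^[q' + i] (f^[q] a - p)) - h (f^[q' + i] a) := by
    intro i
    rw [add_comm q' i, Function.iterate_add_apply, Function.iterate_add_apply,
      iterate_map_sub_intCast hper q', ← Function.iterate_add_apply f q q',
      ← Function.iterate_add_apply f q' q, add_comm q q']
  simp only [h3] at h2
  linarith

/-- The cross-ratio distortion of `f` is controlled by the variation of `h`. -/
def CrossRatioControl (f h : ℝ → ℝ) : Prop :=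
  ∀ a b c d : ℝ, a < b → b < c → c < d →
    crossRatio (f a) (f b) (f c) (f d) ≤ Real.exp (h d - h a) * crossRatio a b c d

theorem CrossRatioControl.iterate (hc : CrossRatioControl f h) (hf : StrictMono f) (N : ℕ)
    {a b c d : ℝ} (hab : a < b) (hbc : b < c) (hcd : c < d) :
    crossRatio (f^[N] a) (f^[N] b) (f^[N] c) (f^[N] d) ≤
      Real.exp (∑ i ∈ Finset.range N, (h (f^[i] d) - h (f^[i] a))) * crossRatio a b c d := by
  induction N with
  | zero => simp
  | succ N ih =>
    simp only [Function.iterate_succ_apply']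
    have hm := hf.iterate N
    refine (hc _ _ _ _ (hm hab) (hm hbc) (hm hcd)).trans ?_
    rw [Finset.sum_range_succ, Real.exp_add, mul_comm (Real.exp _) (Real.exp _), mul_assoc]
    exact mul_le_mul_of_nonneg_left ih (Real.exp_pos _).le

/-- Cross-ratio inequality for configurations inside three consecutive fundamental intervals. -/
theorem ReturnPair.crossRatio_iterate_le (hR : ReturnPair f q q' p p')
    (hc : CrossRatioControl f h) (hf : StrictMono f)
    (hper : ∀ x, f (x + 1) = f x + 1) (hh : Monotone h) (hD : ∀ x, h (x + 1) = h x + D)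
    {N : ℕ} (hN : N ≤ 2 * q') {e₀ e₁ e₂ e₃ a b c d : ℝ}
    (h₁ : e₁ = f^[q] e₀ - p) (h₂ : e₂ = f^[q] e₁ - p) (h₃ : e₃ = f^[q] e₂ - p)
    (ha : e₀ ≤ a) (hab : a < b) (hbc : b < c) (hcd : c < d) (hd : d ≤ e₃) :
    crossRatio (f^[N] a) (f^[N] b) (f^[N] c) (f^[N] d) ≤
      Real.exp (6 * D) * crossRatio a b c d := by
  refine (hc.iterate hf N hab hbc hcd).trans ?_
  have hcr : 0 ≤ crossRatio a b c d := by
    unfold crossRatio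
    apply div_nonneg <;> apply mul_nonneg <;> linarith
  refine mul_le_mul_of_nonneg_right (Real.exp_le_exp.2 ?_) hcr
  have s0 := hR.sum_le_two_mul hf hper hh hD e₀ hN
  have s1 := hR.sum_le_two_mul hf hper hh hD e₁ hN
  have s2 := hR.sum_le_two_mul hf hper hh hD e₂ hN
  rw [← h₁] at s0
  rw [← h₂] at s1
  rw [← h₃] at s2
  have : ∑ i ∈ Finset.range N, (h (f^[i] d) - h (f^[i] a)) ≤
      ∑ i ∈ Finset.range N, ((h (f^[i] e₁) - h (f^[i] e₀)) + (h (f^[i] e₂) - h (f^[i] e₁)) +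
        (h (f^[i] e₃) - h (f^[i] e₂))) := by
    refine Finset.sum_le_sum fun i _ => ?_
    have t1 := hh ((hf.iterate i).monotone ha)
    have t2 := hh ((hf.iterate i).monotone hd)
    linarith
  rw [Finset.sum_add_distrib, Finset.sum_add_distrib] at this
  linarith

/-- Every orbit visits every fundamental interval `[w, F w)` before time `q + q'`. -/
theorem ReturnPair.exists_iterate_mem (hR : ReturnPair f q q' p p') (hf : StrictMono f)
    (hper : ∀ x, f (x + 1) = f x + 1) (hq : 0 < q) (y w : ℝ) :
    ∃ i < q + q', ∃ m : ℤ, w ≤ f^[i] y - m ∧ f^[i] y - m < f^[q] w - p := by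
  set v := f^[q] w - p with hv
  set m : ℕ → ℤ := fun i => ⌊f^[i] y - v⌋ + 1 with hm
  have hlt : ∀ i, f^[i] y - m i < v := by
    intro i
    have := Int.lt_floor_add_one (f^[i] y - v)
    simp only [hm]; push_cast; linarith
  have hmax' : ∀ i (k : ℤ), f^[i] y - k < v → f^[i] y - k ≤ f^[i] y - m i := by
    intro i k hk
    have : ⌊f^[i] y - v⌋ < k := Int.floor_lt.2 (by linarith)
    have : m i ≤ k := by simp only [hm]; omega
    have : (m i : ℝ) ≤ k := by exact_mod_cast this
    linarith
  obtain ⟨i, hi, hmax⟩ := Finset.exists_max_image (Finset.range (q + q'))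
    (fun i => f^[i] y - m i) ⟨0, by simp; omega⟩
  have hmax : ∀ j < q + q', ∀ k : ℤ, f^[i] y - m i < f^[j] y - k → v ≤ f^[j] y - k := by
    intro j hj k hlt'
    by_contra! hcon
    have := hmax' j k hcon
    have := hmax j (Finset.mem_range.2 hj)
    linarith
  have hi := Finset.mem_range.1 hi
  refine ⟨i, hi, m i, ?_, hlt i⟩
  rcases lt_or_ge i q' with hiq | hiq
  · have h1 := hR.right (f^[i] y - m i)
    rw [iterate_map_sub_intCast hper, ← Function.iterate_add_apply] at h1
    have h2 := hmax (q + i) (by omega) (m i + p) (by push_cast; linarith)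
    have h3 : f^[q] (f^[i] y - m i) = f^[q + i] y - m i := by
      rw [iterate_map_sub_intCast hper, ← Function.iterate_add_apply]
    rw [← (hf.iterate q).le_iff_le, h3]
    push_cast at h2
    linarith
  · obtain ⟨k, rfl⟩ := Nat.exists_eq_add_of_le hiq
    have h1 := hR.left (f^[k] y - (m (q' + k) - p' : ℤ))
    have e1 : f^[q'] (f^[k] y - (m (q' + k) - p' : ℤ)) = f^[q' + k] y - (m (q' + k) - p' : ℤ) := by
      rw [iterate_map_sub_intCast hper, ← Function.iterate_add_apply]
    rw [e1] at h1
    have h2 := hmax k (by omega) (m (q' + k) - p') (by push_cast at h1 ⊢; linarith)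
    have h3 := (hf.iterate q').monotone h2
    rw [e1, hv, iterate_map_sub_intCast hper, ← Function.iterate_add_apply, add_comm q' q] at h3
    have h4 := hR.right_add w
    push_cast at h3 h4
    linarith

theorem exists_forall_displacement_le (hcont : Continuous f)
    (hper : ∀ x, f (x + 1) = f x + 1) (q : ℕ) :
    ∃ z, ∀ y, f^[q] z - z ≤ f^[q] y - y := by
  have hc : Continuous fun y => f^[q] y - y := (hcont.iterate q).sub continuous_id
  obtain ⟨z, -, hz⟩ := isCompact_Icc.exists_isMinOn (Set.nonempty_Icc.2 zero_le_one)
    hc.continuousOn (s := Set.Icc (0 : ℝ) 1)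
  refine ⟨z, fun y => ?_⟩
  have h1 := hz (show Int.fract y ∈ Set.Icc (0 : ℝ) 1 from
    ⟨Int.fract_nonneg y, (Int.fract_lt_one y).le⟩)
  simp only [Set.mem_ofPred_eq] at h1
  rw [Int.fract, iterate_map_sub_intCast hper] at h1
  linarith

theorem surjective_of_map_add_one (hcont : Continuous f)
    (hper : ∀ x, f (x + 1) = f x + 1) : Function.Surjective f := by
  intro y
  have e := fun k : ℤ => iterate_map_add_intCast hper 1 0 k
  simp only [Function.iterate_one, zero_add] at e
  have h1 : f (⌊y - f 0⌋ : ℤ) ≤ y := by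
    rw [e]; linarith [Int.floor_le (y - f 0)]
  have h2 : y ≤ f (⌈y - f 0⌉ : ℤ) := by
    rw [e]; linarith [Int.le_ceil (y - f 0)]
  exact mem_range_of_exists_le_of_exists_ge hcont ⟨_, h1⟩ ⟨_, h2⟩

/-- A cross-ratio bounded below makes the middle interval short compared to its neighbours. -/
theorem middle_le_of_crossRatio {a b c d ε : ℝ} (hab : a < b) (hbc : b < c) (hcd : c < d)
    (hε : 0 < ε) (h : ε ≤ crossRatio a b c d) :
    c - b ≤ ε⁻¹ * (b - a) ∧ c - b ≤ ε⁻¹ * (d - c) := by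
  unfold crossRatio at h
  rw [le_div_iff₀ (mul_pos (by linarith) (by linarith))] at h
  have hL : 0 < b - a := by linarith
  have hM : 0 < c - b := by linarith
  have hR : 0 < d - c := by linarith
  rw [inv_mul_eq_div, inv_mul_eq_div, le_div_iff₀ hε, le_div_iff₀ hε]
  constructor
  · by_contra! hcon
    nlinarith [mul_pos hL hM, mul_pos hL hR, mul_pos hM hR, mul_pos hε hL, mul_pos hε hM,
      mul_pos hε hR, mul_pos hε (mul_pos hM hM), mul_pos hε (mul_pos hL hM),
      mul_pos hε (mul_pos hL hR), mul_pos (sub_pos.2 hcon) hR]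
  · by_contra! hcon
    nlinarith [mul_pos hL hM, mul_pos hL hR, mul_pos hM hR, mul_pos hε hL, mul_pos hε hM,
      mul_pos hε hR, mul_pos hε (mul_pos hM hM), mul_pos hε (mul_pos hR hM),
      mul_pos hε (mul_pos hL hR), mul_pos (sub_pos.2 hcon) hL]

theorem le_crossRatio_of_middle_le {a b c d κ : ℝ} (hab : a < b) (hbc : b < c) (hcd : c < d)
    (hκ : 0 < κ) (h₁ : c - b ≤ κ * (b - a)) (h₂ : c - b ≤ κ * (d - c)) :
    ((1 + κ) ^ 2)⁻¹ ≤ crossRatio a b c d := by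
  unfold crossRatio
  have hL : 0 < b - a := by linarith
  have hR : 0 < d - c := by linarith
  rw [le_div_iff₀ (mul_pos (by linarith) (by linarith)), inv_mul_le_iff₀ (by positivity)]
  have h3 : c - a ≤ (1 + κ) * (b - a) := by linarith
  have h4 : d - b ≤ (1 + κ) * (d - c) := by linarith
  calc (c - a) * (d - b) ≤ ((1 + κ) * (b - a)) * ((1 + κ) * (d - c)) :=
        mul_le_mul h3 h4 (by linarith) (by positivity)
    _ = _ := by ring

/-- If the images of three consecutive fundamental intervals are balanced, so are the
intervals themselves. -/
theorem ReturnPair.middle_le_of_image (hR : ReturnPair f q q' p p')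
    (hc : CrossRatioControl f h) (hf : StrictMono f)
    (hper : ∀ x, f (x + 1) = f x + 1) (hh : Monotone h) (hD : ∀ x, h (x + 1) = h x + D)
    {N : ℕ} (hN : N ≤ 2 * q') {e₀ e₁ e₂ e₃ κ : ℝ} (hκ : 0 < κ)
    (h₁ : e₁ = f^[q] e₀ - p) (h₂ : e₂ = f^[q] e₁ - p) (h₃ : e₃ = f^[q] e₂ - p)
    (hL : f^[N] e₂ - f^[N] e₁ ≤ κ * (f^[N] e₁ - f^[N] e₀))
    (hRt : f^[N] e₂ - f^[N] e₁ ≤ κ * (f^[N] e₃ - f^[N] e₂)) :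
    e₂ - e₁ ≤ Real.exp (6 * D) * (1 + κ) ^ 2 * (e₁ - e₀) ∧
      e₂ - e₁ ≤ Real.exp (6 * D) * (1 + κ) ^ 2 * (e₃ - e₂) := by
  have i₁ : e₀ < e₁ := h₁ ▸ hR.right e₀
  have i₂ : e₁ < e₂ := h₂ ▸ hR.right e₁
  have i₃ : e₂ < e₃ := h₃ ▸ hR.right e₂
  have hm := hf.iterate N
  have k1 := le_crossRatio_of_middle_le (hm i₁) (hm i₂) (hm i₃) hκ hL hRt
  have k2 := hR.crossRatio_iterate_le hc hf hper hh hD hN h₁ h₂ h₃ le_rfl i₁ i₂ i₃ le_rfl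
  have k3 := k1.trans k2
  have k4 : (Real.exp (6 * D) * (1 + κ) ^ 2)⁻¹ ≤ crossRatio e₀ e₁ e₂ e₃ := by
    rw [mul_inv, inv_mul_le_iff₀ (Real.exp_pos _)]
    exact k3
  have k5 := middle_le_of_crossRatio i₁ i₂ i₃ (by positivity) k4
  rwa [inv_inv] at k5

/-- **Real bounds**: consecutive fundamental intervals have comparable lengths. -/
theorem exists_real_bounds (hc : CrossRatioControl f h) (hf : StrictMono f) (hcont : Continuous f)
    (hper : ∀ x, f (x + 1) = f x + 1) (hh : Monotone h) (hD : ∀ x, h (x + 1) = h x + D) :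
    ∃ K : ℝ, 0 < K ∧ ∀ (q q' : ℕ) (p p' : ℤ), 0 < q → ReturnPair f q q' p p' →
      ∀ e₀ e₁ e₂ : ℝ, e₁ = f^[q] e₀ - p → e₂ = f^[q] e₁ - p →
        e₂ - e₁ ≤ K * (e₁ - e₀) ∧ e₁ - e₀ ≤ K * (e₂ - e₁) := by
  set B := Real.exp (6 * D) with hB
  have hB0 : 0 < B := Real.exp_pos _
  set K₁ := B * (1 + 1) ^ 2 with hK₁
  set K₂ := B * (1 + (1 + K₁)) ^ 2 with hK₂
  have hK₁0 : 0 < K₁ := by positivity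
  refine ⟨K₂, by positivity, fun q q' p p' hq hR => ?_⟩
  obtain ⟨z, hz⟩ := exists_forall_displacement_le hcont hper q
  have hsurj : ∀ y, ∃ x, y = f^[q] x - p := by
    intro y
    obtain ⟨x, hx⟩ := (surjective_of_map_add_one hcont hper).iterate q (y + p)
    exact ⟨x, by linarith⟩
  set μ := f^[q] z - p - z with hμ
  have hmin : ∀ y, μ ≤ f^[q] y - p - y := fun y => by have := hz y; linarith
  have hμ0 : 0 < μ := sub_pos.2 (hR.right z)
  obtain ⟨w, hw⟩ := hsurj z
  obtain ⟨u, hu⟩ := hsurj w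
  have hwz : z - w ≤ K₁ * μ := by
    refine (hR.middle_le_of_image hc hf hper hh hD (N := q) (by have := hR.le; omega)
      one_pos hu hw rfl ?_ ?_).2
    · linarith [hmin w]
    · linarith [hmin (f^[q] z - p)]
  have key : ∀ e₀ e₁ e₂ e₃ : ℝ, e₁ = f^[q] e₀ - p → e₂ = f^[q] e₁ - p → e₃ = f^[q] e₂ - p →
      e₂ - e₁ ≤ K₂ * (e₁ - e₀) ∧ e₂ - e₁ ≤ K₂ * (e₃ - e₂) := by
    intro e₀ e₁ e₂ e₃ h₁ h₂ h₃
    obtain ⟨i, hi, m, hm₁, hm₂⟩ := hR.exists_iterate_mem hf hper hq e₁ w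
    have comm : ∀ x, f^[i] (f^[q] x - p) = f^[q] (f^[i] x) - p := fun x => by
      rw [iterate_map_sub_intCast hper, ← Function.iterate_add_apply, add_comm,
        Function.iterate_add_apply]
    have hM : f^[i] e₂ - f^[i] e₁ ≤ (1 + K₁) * μ := by
      have t1 : f^[q] (f^[i] e₁ - m) ≤ f^[q] z := (hf.iterate q).monotone (by linarith)
      rw [iterate_map_sub_intCast hper] at t1
      rw [h₂, comm]
      linarith
    have hL : μ ≤ f^[i] e₁ - f^[i] e₀ := by
      rw [h₁, comm]; exact hmin _
    have hRt : μ ≤ f^[i] e₃ - f^[i] e₂ := by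
      rw [h₃, comm]; exact hmin _
    refine hR.middle_le_of_image hc hf hper hh hD (N := i) (by have := hR.le; omega)
      (by positivity) h₁ h₂ h₃ ?_ ?_
    · exact hM.trans (mul_le_mul_of_nonneg_left hL (by positivity))
    · exact hM.trans (mul_le_mul_of_nonneg_left hRt (by positivity))
  intro e₀ e₁ e₂ h₁ h₂
  obtain ⟨e, he⟩ := hsurj e₀
  exact ⟨(key e₀ e₁ e₂ _ h₁ h₂ rfl).1, (key e e₀ e₁ e₂ he h₁ h₂).2⟩

/-- The `C¹` bounds for lifts with controlled cross-ratio distortion. -/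
theorem exists_deriv_iterate_le (hc : CrossRatioControl f h) (hf : StrictMono f)
    (hdiff : Differentiable ℝ f) (hper : ∀ x, f (x + 1) = f x + 1) (hh : Monotone h)
    (hD : ∀ x, h (x + 1) = h x + D) :
    ∃ K : ℝ, 1 < K ∧ ∀ (q q' : ℕ) (p p' : ℤ), 0 < q → ReturnPair f q q' p p' →
      ∀ a b x : ℝ, b = f^[q] a - p → a ≤ x → x ≤ b → ∀ j ≤ q',
        deriv (f^[j]) x ≤ K * ((f^[j] b - f^[j] a) / (b - a)) := by
  obtain ⟨K, hK, hreal⟩ := exists_real_bounds hc hf hdiff.continuous hper hh hD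
  set B := Real.exp (6 * D) with hB
  have hB0 : 0 < B := Real.exp_pos _
  refine ⟨2 * B * (1 + K) ^ 2 + 1, by linarith [show 0 < 2 * B * (1 + K) ^ 2 by positivity],
    fun q q' p p' hq hR a b x hb hax hxb j hj => ?_⟩
  obtain ⟨e, he⟩ : ∃ e, a = f^[q] e - p := by
    obtain ⟨x, hx⟩ := (surjective_of_map_add_one hdiff.continuous hper).iterate q (a + p)
    exact ⟨x, by linarith⟩
  obtain ⟨d, hd⟩ : ∃ d, d = f^[q] b - p := ⟨_, rfl⟩
  have iea : e < a := he ▸ hR.right e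
  have iab : a < b := hb ▸ hR.right a
  have ibd : b < d := hd ▸ hR.right b
  have hm : StrictMono f^[j] := hf.iterate j
  have hjN : j ≤ 2 * q' := by omega
  have comm : ∀ x, f^[j] (f^[q] x - p) = f^[q] (f^[j] x) - p := fun x => by
    rw [iterate_map_sub_intCast hper, ← Function.iterate_add_apply, add_comm,
      Function.iterate_add_apply]
  obtain ⟨r1, r2⟩ := hreal q q' p p' hq hR (f^[j] e) (f^[j] a) (f^[j] b)
    (by rw [he, comm]) (by rw [hb, comm])
  obtain ⟨r3, r4⟩ := hreal q q' p p' hq hR (f^[j] a) (f^[j] b) (f^[j] d)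
    (by rw [hb, comm]) (by rw [hd, comm])
  set I := b - a with hI
  set g := f^[j] with hg
  set J := g b - g a with hJ
  have hI0 : 0 < I := sub_pos.2 iab
  have hJ0 : 0 < J := sub_pos.2 (hm iab)
  have hgd : HasDerivAt g (deriv g x) x := (hdiff.iterate j x).hasDerivAt
  have hslope := hasDerivAt_iff_tendsto_slope.1 hgd
  have hfin : 2 * B * (1 + K) ^ 2 * (J / I) ≤ (2 * B * (1 + K) ^ 2 + 1) * (J / I) := by
    have : 0 < J / I := by positivity
    linarith
  refine le_trans ?_ hfin
  have hcr := fun {a b c d : ℝ} => hR.crossRatio_iterate_le (a := a) (b := b) (c := c) (d := d)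
    hc hf hper hh hD hjN he hb hd
  rw [← hB, ← hg] at hcr
  unfold crossRatio at hcr
  rcases le_total x ((a + b) / 2) with hx | hx
  · have hev : ∀ᶠ y in 𝓝[<] x, slope g x y ≤ 2 * B * (1 + K) ^ 2 * (J / I) := by
      filter_upwards [Ioo_mem_nhdsLT (show e < x by linarith)] with y hy
      obtain ⟨hey, hyx⟩ := hy
      have hxb' : x < b := by linarith
      have h1 := hcr hey.le hyx hxb' ibd le_rfl
      have g1 := hm hyx
      have g2 := hm hxb'
      have g3 := hm ibd
      have g4 := hm hey
      have g5 := hm.monotone hax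
      rw [slope_def_field, ← neg_div_neg_eq, neg_sub, neg_sub, div_le_iff₀ (by linarith)]
      rw [div_le_iff₀ (mul_pos (by linarith) (by linarith)), mul_div_assoc', div_mul_eq_mul_div,
        le_div_iff₀ (mul_pos (by linarith) (by linarith))] at h1
      have h2 : g b - g y ≤ (1 + K) * J := by linarith
      have h3 : g d - g x ≤ (1 + K) * (g d - g b) := by linarith
      have h4 : I / 2 ≤ b - y := by linarith
      have h5 : d - b ≤ d - x := by linarith
      have h6 : (g x - g y) * (g d - g b) * (I / 2 * (d - b)) ≤
          B * ((x - y) * (d - b)) * ((1 + K) * J * ((1 + K) * (g d - g b))) := by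
        calc _ ≤ (g x - g y) * (g d - g b) * ((b - y) * (d - x)) := by
              refine mul_le_mul_of_nonneg_left ?_ (mul_nonneg (by linarith) (by linarith))
              exact mul_le_mul h4 h5 (by linarith) (by linarith)
          _ ≤ B * ((x - y) * (d - b)) * ((g b - g y) * (g d - g x)) := h1
          _ ≤ _ := by
              refine mul_le_mul_of_nonneg_left ?_
                (mul_nonneg hB0.le (mul_nonneg (by linarith) (by linarith)))
              exact mul_le_mul h2 h3 (by linarith) (by positivity)
      have h7 : 0 < (g d - g b) * (d - b) := mul_pos (by linarith) (by linarith)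
      have h8 : (g x - g y) * (I / 2) ≤ B * (x - y) * ((1 + K) ^ 2 * J) := by
        refine le_of_mul_le_mul_right ?_ h7
        linarith
      rw [mul_div_assoc', div_mul_eq_mul_div, le_div_iff₀ hI0]
      linarith
    exact le_of_tendsto (hslope.mono_left (nhdsWithin_mono x (s := Iio x) fun y hy => ne_of_lt hy)) hev
  · have hev : ∀ᶠ y in 𝓝[>] x, slope g x y ≤ 2 * B * (1 + K) ^ 2 * (J / I) := by
      filter_upwards [Ioo_mem_nhdsGT (show x < d by linarith)] with y hy
      obtain ⟨hxy, hyd⟩ := hy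
      have hax' : a < x := by linarith
      have h1 := hcr le_rfl iea hax' hxy hyd.le
      have g1 := hm hxy
      have g2 := hm hax'
      have g3 := hm iea
      have g4 := hm hyd
      have g5 := hm.monotone hxb
      rw [slope_def_field, div_le_iff₀ (by linarith)]
      rw [div_le_iff₀ (mul_pos (by linarith) (by linarith)), mul_div_assoc', div_mul_eq_mul_div,
        le_div_iff₀ (mul_pos (by linarith) (by linarith))] at h1
      have h2 : g y - g a ≤ (1 + K) * J := by linarith
      have h3 : g x - g e ≤ (1 + K) * (g a - g e) := by linarith
      have h4 : I / 2 ≤ y - a := by linarith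
      have h5 : a - e ≤ x - e := by linarith
      have h6 : (g a - g e) * (g y - g x) * ((a - e) * (I / 2)) ≤
          B * ((a - e) * (y - x)) * ((1 + K) * (g a - g e) * ((1 + K) * J)) := by
        calc _ ≤ (g a - g e) * (g y - g x) * ((x - e) * (y - a)) := by
              refine mul_le_mul_of_nonneg_left ?_ (mul_nonneg (by linarith) (by linarith))
              exact mul_le_mul h5 h4 (by linarith) (by linarith)
          _ ≤ B * ((a - e) * (y - x)) * ((g x - g e) * (g y - g a)) := h1
          _ ≤ _ := by
              refine mul_le_mul_of_nonneg_left ?_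
                (mul_nonneg hB0.le (mul_nonneg (by linarith) (by linarith)))
              exact mul_le_mul h3 h2 (by linarith)
                (mul_nonneg (by linarith) (by linarith))
      have h7 : 0 < (g a - g e) * (a - e) := mul_pos (by linarith) (by linarith)
      have h8 : (g y - g x) * (I / 2) ≤ B * (y - x) * ((1 + K) ^ 2 * J) := by
        refine le_of_mul_le_mul_right ?_ h7
        linarith
      rw [mul_div_assoc', div_mul_eq_mul_div, le_div_iff₀ hI0]
      linarith
    exact le_of_tendsto (hslope.mono_left (nhdsWithin_mono x (s := Ioi x) fun y hy => ne_of_gt hy)) hev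

end LiftDynamics

section ReturnTimes

variable {ρ : ℝ}

theorem gaussMap_iterate_mem (hρ : Irrational ρ) (n : ℕ) :
    Irrational (gaussMap^[n] (Int.fract ρ)) ∧ gaussMap^[n] (Int.fract ρ) ∈ Ioo (0 : ℝ) 1 := by
  have key : ∀ x : ℝ, Irrational x → Irrational (Int.fract x) ∧ Int.fract x ∈ Ioo (0 : ℝ) 1 := by
    intro x hx
    have h1 : Irrational (Int.fract x) := hx.sub_intCast _
    exact ⟨h1, lt_of_le_of_ne (Int.fract_nonneg x) h1.ne_zero.symm, Int.fract_lt_one x⟩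
  induction n with
  | zero => exact key ρ hρ
  | succ n ih =>
    rw [Function.iterate_succ_apply']
    exact key _ (irrational_inv_iff.2 ih.1)

theorem gaussMap_iterate_succ (hρ : Irrational ρ) (n : ℕ) :
    gaussMap^[n + 1] (Int.fract ρ) = (gaussMap^[n] (Int.fract ρ))⁻¹ - cfA ρ n := by
  have h := (gaussMap_iterate_mem hρ n).2
  rw [Function.iterate_succ_apply']
  unfold gaussMap cfA
  rw [natCast_floor_eq_intCast_floor (inv_nonneg.2 h.1.le)]
  rfl

theorem one_le_cfA (hρ : Irrational ρ) (n : ℕ) : 1 ≤ cfA ρ n := by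
  have h := (gaussMap_iterate_mem hρ n).2
  unfold cfA
  rw [Nat.one_le_floor_iff]
  exact (one_le_inv₀ h.1).2 h.2.le

theorem qden_pos (hρ : Irrational ρ) : ∀ n, 0 < qden ρ n
  | 0 => one_pos
  | 1 => one_le_cfA hρ 0
  | n + 2 => by
    have := qden_pos hρ n
    rw [qden]; omega

theorem qden_le_succ (hρ : Irrational ρ) : ∀ n, qden ρ n ≤ qden ρ (n + 1)
  | 0 => one_le_cfA hρ 0
  | n + 1 => by
    have := Nat.mul_le_mul_right (qden ρ (n + 1)) (one_le_cfA hρ (n + 1))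
    rw [qden]; omega

theorem qden_mul_pnum_sub (n : ℕ) :
    (qden ρ n : ℤ) * pnum ρ (n + 1) - qden ρ (n + 1) * pnum ρ n = (-1) ^ n := by
  induction n with
  | zero => simp [qden, pnum]
  | succ n ih =>
    rw [qden, pnum, pow_succ, ← ih]
    push_cast
    ring

theorem qden_mul_sub_pnum_succ (hρ : Irrational ρ) (hρ' : ρ ∈ Ioo (0 : ℝ) 1) (n : ℕ) :
    qden ρ (n + 1) * ρ - pnum ρ (n + 1) =
      -(gaussMap^[n + 1] (Int.fract ρ)) * (qden ρ n * ρ - pnum ρ n) := by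
  induction n with
  | zero =>
    rw [gaussMap_iterate_succ hρ]
    have : Int.fract ρ = ρ := Int.fract_eq_self.2 ⟨hρ'.1.le, hρ'.2⟩
    have h0 : ρ ≠ 0 := hρ'.1.ne'
    simp only [qden, pnum, Function.iterate_zero, id, this]
    field_simp
    push_cast
    ring
  | succ n ih =>
    rw [gaussMap_iterate_succ hρ (n + 1)]
    have h0 := (gaussMap_iterate_mem hρ (n + 1)).2.1.ne'
    have e : (qden ρ n * ρ - pnum ρ n) = -(gaussMap^[n + 1] (Int.fract ρ))⁻¹ *
        (qden ρ (n + 1) * ρ - pnum ρ (n + 1)) := by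
      rw [ih]; field_simp
    rw [qden, pnum]
    push_cast
    linear_combination e

theorem qden_mul_sub_pnum_sign (hρ : Irrational ρ) (hρ' : ρ ∈ Ioo (0 : ℝ) 1) (n : ℕ) :
    0 < (-1) ^ n * (qden ρ n * ρ - pnum ρ n) := by
  induction n with
  | zero => simpa [qden, pnum] using hρ'.1
  | succ n ih =>
    rw [qden_mul_sub_pnum_succ hρ hρ']
    have := mul_pos (gaussMap_iterate_mem hρ (n + 1)).2.1 ih
    rw [pow_succ]
    linarith

theorem qden_mul_sub_pnum_add_sign (hρ : Irrational ρ) (hρ' : ρ ∈ Ioo (0 : ℝ) 1) (n : ℕ) :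
    0 < (-1) ^ n * ((qden ρ n * ρ - pnum ρ n) + (qden ρ (n + 1) * ρ - pnum ρ (n + 1))) := by
  rw [qden_mul_sub_pnum_succ hρ hρ']
  have := mul_pos (sub_pos.2 (gaussMap_iterate_mem hρ (n + 1)).2.2)
    (qden_mul_sub_pnum_sign hρ hρ' n)
  linarith

variable {f : ℝ → ℝ}

theorem iterate_sub_order (hf : Monotone f) (hper : ∀ x, f (x + 1) = f x + 1)
    (hrot : HasRotNumber f ρ) (m : ℕ) (k : ℤ) (x : ℝ) :
    (0 < m * ρ - k → x < f^[m] x - k) ∧ (m * ρ - k < 0 → f^[m] x - k < x) := by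
  let g : CircleDeg1Lift := ⟨⟨f, hf⟩, hper⟩
  have hg : g.translationNumber = ρ := by
    refine tendsto_nhds_unique g.tendsto_translation_number₀ ?_
    simp only [CircleDeg1Lift.coe_pow]
    exact hrot
  have hgm : (g ^ m).translationNumber = m * ρ := by
    rw [CircleDeg1Lift.translationNumber_pow, hg]
  have hx : (g ^ m) x = f^[m] x := by rw [CircleDeg1Lift.coe_pow]; rfl
  constructor
  · intro h
    have := (g ^ m).lt_map_of_int_lt_translationNumber (n := k) (by rw [hgm]; linarith) x
    rw [hx] at this; linarith
  · intro h
    have := (g ^ m).map_lt_of_translationNumber_lt_int (n := k) (by rw [hgm]; linarith) x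
    rw [hx] at this; linarith

theorem returnPair_of_even (hf : Monotone f) (hper : ∀ x, f (x + 1) = f x + 1)
    (hrot : HasRotNumber f ρ) (hρ : Irrational ρ) (hρ' : ρ ∈ Ioo (0 : ℝ) 1) {n : ℕ}
    (hn : Even n) :
    ReturnPair f (qden ρ n) (qden ρ (n + 1)) (pnum ρ n) (pnum ρ (n + 1)) := by
  have s1 := qden_mul_sub_pnum_sign hρ hρ' n
  have s2 := qden_mul_sub_pnum_sign hρ hρ' (n + 1)
  have s3 := qden_mul_sub_pnum_add_sign hρ hρ' n
  rw [pow_succ] at s2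
  rw [hn.neg_one_pow] at s1 s2 s3
  refine ⟨qden_le_succ hρ n, ?_, fun x => ?_, fun x => ?_, fun x => ?_⟩
  · rw [qden_mul_pnum_sub, hn.neg_one_pow]
  · exact (iterate_sub_order hf hper hrot _ _ x).1 (by push_cast; linarith)
  · exact (iterate_sub_order hf hper hrot _ _ x).2 (by push_cast; linarith)
  · exact (iterate_sub_order hf hper hrot _ _ x).1 (by push_cast; linarith)

/-- Conjugation of a map by the reflection `x ↦ -x`. -/
def conjNeg (f : ℝ → ℝ) (x : ℝ) : ℝ := -f (-x)

theorem conjNeg_iterate (f : ℝ → ℝ) (n : ℕ) (x : ℝ) : (conjNeg f)^[n] x = -f^[n] (-x) := by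
  induction n generalizing x with
  | zero => simp
  | succ n ih => rw [Function.iterate_succ_apply, ih, Function.iterate_succ_apply]; simp [conjNeg]

theorem returnPair_conjNeg_of_odd (hf : Monotone f) (hper : ∀ x, f (x + 1) = f x + 1)
    (hrot : HasRotNumber f ρ) (hρ : Irrational ρ) (hρ' : ρ ∈ Ioo (0 : ℝ) 1) {n : ℕ}
    (hn : Odd n) :
    ReturnPair (conjNeg f) (qden ρ n) (qden ρ (n + 1)) (-pnum ρ n) (-pnum ρ (n + 1)) := by
  have s1 := qden_mul_sub_pnum_sign hρ hρ' n
  have s2 := qden_mul_sub_pnum_sign hρ hρ' (n + 1)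
  have s3 := qden_mul_sub_pnum_add_sign hρ hρ' n
  rw [pow_succ] at s2
  rw [hn.neg_one_pow] at s1 s2 s3
  refine ⟨qden_le_succ hρ n, ?_, fun x => ?_, fun x => ?_, fun x => ?_⟩
  · have := qden_mul_pnum_sub (ρ := ρ) n
    rw [hn.neg_one_pow] at this
    linarith
  · have := (iterate_sub_order hf hper hrot (qden ρ n) (pnum ρ n) (-x)).2
      (by push_cast; linarith)
    rw [conjNeg_iterate]; push_cast at this ⊢; linarith
  · have := (iterate_sub_order hf hper hrot (qden ρ (n + 1)) (pnum ρ (n + 1)) (-x)).1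
      (by push_cast; linarith)
    rw [conjNeg_iterate]; push_cast at this ⊢; linarith
  · have := (iterate_sub_order hf hper hrot (qden ρ n + qden ρ (n + 1))
      (pnum ρ n + pnum ρ (n + 1)) (-x)).2 (by push_cast; linarith)
    rw [conjNeg_iterate]; push_cast at this ⊢; linarith

theorem crossRatio_neg_reverse (a b c d : ℝ) :
    crossRatio (-d) (-c) (-b) (-a) = crossRatio a b c d := by
  unfold crossRatio
  congr 1 <;> ring

theorem CrossRatioControl.conj {h : ℝ → ℝ} (hc : CrossRatioControl f h) :
    CrossRatioControl (conjNeg f) (conjNeg h) := by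
  intro a b c d hab hbc hcd
  have := hc (-d) (-c) (-b) (-a) (neg_lt_neg hcd) (neg_lt_neg hbc) (neg_lt_neg hab)
  rw [crossRatio_neg_reverse] at this
  rw [conjNeg, conjNeg, conjNeg, conjNeg, crossRatio_neg_reverse,
    conjNeg, conjNeg]
  rwa [show -h (-d) - -h (-a) = h (-a) - h (-d) by ring]

theorem map_add_one_conjNeg {h : ℝ → ℝ} {D : ℝ} (hD : ∀ x, h (x + 1) = h x + D) (x : ℝ) :
    conjNeg h (x + 1) = conjNeg h x + D := by
  have := hD (-(x + 1))
  rw [neg_add, neg_add_cancel_right] at this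
  simp only [conjNeg]
  rw [neg_add]
  linarith

theorem exists_deriv_iterate_le_of_hasRotNumber {h : ℝ → ℝ} {D : ℝ}
    (hc : CrossRatioControl f h) (hf : StrictMono f)
    (hdiff : Differentiable ℝ f) (hper : ∀ x, f (x + 1) = f x + 1) (hh : Monotone h)
    (hD : ∀ x, h (x + 1) = h x + D)
    (hrot : HasRotNumber f ρ) (hρ : Irrational ρ) (hρ' : ρ ∈ Ioo (0 : ℝ) 1) :
    ∃ K : ℝ, 1 < K ∧ ∀ c₀ : ℝ, ∀ n, ∀ x ∈ arcI f ρ c₀ n, ∀ j ≤ qden ρ (n + 1),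
      deriv (f^[j]) x ≤ K * (arcImgLen f ρ c₀ n j / arcLen f ρ c₀ n) := by
  obtain ⟨K₁, hK₁, H₁⟩ := exists_deriv_iterate_le hc hf hdiff hper hh hD
  have hfr : StrictMono (conjNeg f) := fun x y hxy => neg_lt_neg (hf (neg_lt_neg hxy))
  have hdr : Differentiable ℝ (conjNeg f) := (hdiff.comp differentiable_neg).neg
  have hhr : Monotone (conjNeg h) := fun x y hxy => neg_le_neg (hh (neg_le_neg hxy))
  obtain ⟨K₂, hK₂, H₂⟩ := exists_deriv_iterate_le hc.conj hfr hdr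
    (map_add_one_conjNeg hper) hhr (map_add_one_conjNeg hD)
  refine ⟨max K₁ K₂, lt_max_of_lt_left hK₁, fun c₀ n x hx j hj => ?_⟩
  have hnn : 0 ≤ arcImgLen f ρ c₀ n j / arcLen f ρ c₀ n := div_nonneg (abs_nonneg _) (abs_nonneg _)
  rcases Nat.even_or_odd n with hn | hn
  · refine le_trans ?_ (mul_le_mul_of_nonneg_right (le_max_left _ _) hnn)
    have hR := returnPair_of_even hf.monotone hper hrot hρ hρ' hn
    have hlt := hR.right c₀
    unfold arcI arcImgLen arcLen retPt at *
    push_cast at hlt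
    rw [uIcc_of_le hlt.le] at hx
    have := H₁ _ _ _ _ (qden_pos hρ n) hR c₀ _ x rfl hx.1
      (by push_cast; exact hx.2) j hj
    push_cast at this
    rwa [abs_of_pos (sub_pos.2 (hf.iterate j hlt)), abs_of_pos (sub_pos.2 hlt)]
  · refine le_trans ?_ (mul_le_mul_of_nonneg_right (le_max_right _ _) hnn)
    have hR := returnPair_conjNeg_of_odd hf.monotone hper hrot hρ hρ' hn
    have hlt := hR.right (-c₀)
    rw [conjNeg_iterate, neg_neg] at hlt
    unfold arcI arcImgLen arcLen retPt at *
    push_cast at hlt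
    have hlt' : f^[qden ρ n] c₀ - pnum ρ n < c₀ := by linarith
    rw [uIcc_of_ge hlt'.le] at hx
    have := H₂ _ _ _ _ (qden_pos hρ n) hR (-c₀) _ (-x) rfl (by linarith [hx.2])
      (by rw [conjNeg_iterate, neg_neg]; push_cast; linarith [hx.1]) j hj
    have e1 : -(-f^[qden ρ n] c₀ - -(pnum ρ n : ℝ)) = f^[qden ρ n] c₀ - pnum ρ n := by ring
    have e2 : (conjNeg f)^[j] = fun y => -f^[j] (-y) := funext (conjNeg_iterate f j)
    have e3 : deriv (conjNeg f)^[j] (-x) = deriv f^[j] x := by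
      rw [e2, deriv.fun_neg, deriv_comp_neg (f^[j]), neg_neg, neg_neg]
    rw [e3, conjNeg_iterate, conjNeg_iterate, conjNeg_iterate] at this
    push_cast at this
    rw [neg_neg, e1] at this
    rw [abs_of_neg (sub_neg.2 (hf.iterate j hlt')), abs_of_neg (sub_neg.2 hlt')]
    have e4 : ∀ u v : ℝ, -(u - v) = -u - -v := fun u v => by ring
    rwa [e4, e4, e4]

end ReturnTimes

section Distortion

theorem sinh_mul_mul_sinh_le {α : ℝ} (hα : 1 ≤ α) {ξ η : ℝ} (hξ : 0 < ξ) (h : ξ ≤ η) :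
    Real.sinh (α * ξ) * Real.sinh η ≤ Real.sinh (α * η) * Real.sinh ξ := by
  have ds : ∀ t, HasDerivAt (fun t => Real.sinh (α * t)) (Real.cosh (α * t) * α) t := fun t => by
    simpa using ((hasDerivAt_id t).const_mul α).sinh
  have dc : ∀ t, HasDerivAt (fun t => Real.cosh (α * t)) (Real.sinh (α * t) * α) t := fun t => by
    simpa using ((hasDerivAt_id t).const_mul α).cosh
  have hk : ∀ t, 0 ≤ t → 0 ≤ Real.cosh (α * t) * α * Real.sinh t -
      Real.sinh (α * t) * Real.cosh t := by
    have dk : ∀ t, HasDerivAt (fun t => Real.cosh (α * t) * α * Real.sinh t -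
        Real.sinh (α * t) * Real.cosh t)
        ((α ^ 2 - 1) * (Real.sinh (α * t) * Real.sinh t)) t := fun t => by
      refine ((((dc t).mul_const α).mul (Real.hasDerivAt_sinh t)).sub
        ((ds t).mul (Real.hasDerivAt_cosh t))).congr_deriv ?_
      ring
    have hmono := monotoneOn_of_deriv_nonneg (convex_Ici (0 : ℝ))
      (fun t _ => (dk t).continuousAt.continuousWithinAt)
      (fun t _ => (dk t).differentiableAt.differentiableWithinAt) (fun t ht => by
        rw [(dk t).deriv]
        rw [interior_Ici] at ht
        have ht : 0 < t := ht
        have h1 := Real.sinh_pos_iff.2 ht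
        have h2 := Real.sinh_pos_iff.2 (show 0 < α * t by positivity)
        have h3 : 0 ≤ α ^ 2 - 1 := by nlinarith
        positivity)
    intro t ht
    simpa using hmono (Set.mem_Ici.2 le_rfl) (Set.mem_Ici.2 ht) ht
  have dr : ∀ t, 0 < t → HasDerivAt (fun t => Real.sinh (α * t) / Real.sinh t)
      ((Real.cosh (α * t) * α * Real.sinh t - Real.sinh (α * t) * Real.cosh t) /
        Real.sinh t ^ 2) t := fun t ht =>
    (ds t).div (Real.hasDerivAt_sinh t) (Real.sinh_pos_iff.2 ht).ne'
  have hmono := monotoneOn_of_deriv_nonneg (convex_Ioi (0 : ℝ))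
    (fun t ht => (dr t ht).continuousAt.continuousWithinAt)
    (fun t ht => (dr t (interior_subset ht)).differentiableAt.differentiableWithinAt)
    (fun t ht => by
      have ht := interior_subset ht
      rw [(dr t ht).deriv]
      exact div_nonneg (hk t (le_of_lt ht)) (sq_nonneg _))
  have hη : 0 < η := hξ.trans_le h
  have := hmono (show ξ ∈ Ioi (0 : ℝ) from hξ) (show η ∈ Ioi (0 : ℝ) from hη) h
  simp only at this
  rwa [div_le_div_iff₀ (Real.sinh_pos_iff.2 hξ) (Real.sinh_pos_iff.2 hη)] at this

theorem crossRatio_le_mul_of_slope_le {a b c d A B C D E : ℝ} (hab : a < b) (hbc : b < c)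
    (hcd : c < d) (hAB : A < B) (hBC : B < C) (hCD : C < D)
    (h : (B - A) / (b - a) * ((D - C) / (d - c)) ≤
      E * ((C - A) / (c - a) * ((D - B) / (d - b)))) :
    crossRatio A B C D ≤ E * crossRatio a b c d := by
  unfold crossRatio
  have h1 : 0 < b - a := by linarith
  have h2 : 0 < d - c := by linarith
  have h3 : 0 < c - a := by linarith
  have h4 : 0 < d - b := by linarith
  have h5 : 0 < C - A := by linarith
  have h6 : 0 < D - B := by linarith
  rw [div_mul_div_comm, div_mul_div_comm, mul_div_assoc',
    div_le_div_iff₀ (by positivity) (by positivity)] at h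
  rw [mul_div_assoc', div_le_div_iff₀ (by positivity) (by positivity)]
  linarith

theorem exp_sub_exp_eq_sinh (u v : ℝ) :
    Real.exp (2 * u) - Real.exp (2 * v) = 2 * Real.exp (u + v) * Real.sinh (u - v) := by
  rw [Real.sinh_eq]
  have h1 : Real.exp (2 * u) = Real.exp (u + v) * Real.exp (u - v) := by
    rw [← Real.exp_add]; ring_nf
  have h2 : Real.exp (2 * v) = Real.exp (u + v) * Real.exp (-(u - v)) := by
    rw [← Real.exp_add]; ring_nf
  rw [h1, h2]; ring

/-- Power maps contract cross-ratios on the positive half-line. -/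
theorem crossRatio_rpow_le {α : ℝ} (hα : 1 ≤ α) {a b c d : ℝ} (ha : 0 < a) (hab : a < b)
    (hbc : b < c) (hcd : c < d) :
    crossRatio (a ^ α) (b ^ α) (c ^ α) (d ^ α) ≤ crossRatio a b c d := by
  have hα0 : 0 < α := by linarith
  have param : ∀ x : ℝ, 0 < x → ∃ u, x = Real.exp (2 * u) := fun x hx =>
    ⟨Real.log x / 2, by rw [mul_div_cancel₀ _ two_ne_zero, Real.exp_log hx]⟩
  obtain ⟨u₁, rfl⟩ := param a ha
  obtain ⟨u₂, rfl⟩ := param b (by linarith)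
  obtain ⟨u₃, rfl⟩ := param c (by linarith)
  obtain ⟨u₄, rfl⟩ := param d (by linarith)
  have h12 : u₁ < u₂ := by linarith [Real.exp_lt_exp.1 hab]
  have h23 : u₂ < u₃ := by linarith [Real.exp_lt_exp.1 hbc]
  have h34 : u₃ < u₄ := by linarith [Real.exp_lt_exp.1 hcd]
  have hpow : ∀ u, Real.exp (2 * u) ^ α = Real.exp (2 * (α * u)) := fun u => by
    rw [← Real.exp_mul]; ring_nf
  have hpos : ∀ {u v : ℝ}, u < v → 0 < Real.sinh (v - u) := fun h =>
    Real.sinh_pos_iff.2 (sub_pos.2 h)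
  have hposα : ∀ {u v : ℝ}, u < v → 0 < Real.sinh (α * (v - u)) := fun h =>
    Real.sinh_pos_iff.2 (mul_pos hα0 (sub_pos.2 h))
  have k1 := sinh_mul_mul_sinh_le hα (sub_pos.2 h12) (show u₂ - u₁ ≤ u₃ - u₁ by linarith)
  have k2 := sinh_mul_mul_sinh_le hα (sub_pos.2 h34) (show u₄ - u₃ ≤ u₄ - u₂ by linarith)
  have k3 := mul_le_mul k1 k2 (mul_pos (hposα h34) (hpos (h23.trans h34))).le
    (mul_pos (hposα (h12.trans h23)) (hpos h12)).le
  have q1 := hpos h12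
  have q2 := hpos h34
  have q3 := hpos (h12.trans h23)
  have q4 := hpos (h23.trans h34)
  have q5 := hposα (h12.trans h23)
  have q6 := hposα (h23.trans h34)
  unfold crossRatio
  simp only [hpow, exp_sub_exp_eq_sinh, ← mul_sub]
  rw [div_le_div_iff₀ (by positivity) (by positivity)]
  have e1 : Real.exp (α * u₂ + α * u₁) * Real.exp (α * u₄ + α * u₃) =
      Real.exp (α * u₃ + α * u₁) * Real.exp (α * u₄ + α * u₂) := by
    rw [← Real.exp_add, ← Real.exp_add]; ring_nf
  have e2 : Real.exp (u₂ + u₁) * Real.exp (u₄ + u₃) =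
      Real.exp (u₃ + u₁) * Real.exp (u₄ + u₂) := by
    rw [← Real.exp_add, ← Real.exp_add]; ring_nf
  calc _ = 16 * (Real.exp (α * u₂ + α * u₁) * Real.exp (α * u₄ + α * u₃)) *
        (Real.exp (u₃ + u₁) * Real.exp (u₄ + u₂)) *
        (Real.sinh (α * (u₂ - u₁)) * Real.sinh (u₃ - u₁) *
          (Real.sinh (α * (u₄ - u₃)) * Real.sinh (u₄ - u₂))) := by ring
    _ ≤ 16 * (Real.exp (α * u₂ + α * u₁) * Real.exp (α * u₄ + α * u₃)) *
        (Real.exp (u₃ + u₁) * Real.exp (u₄ + u₂)) *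
        (Real.sinh (α * (u₃ - u₁)) * Real.sinh (u₂ - u₁) *
          (Real.sinh (α * (u₄ - u₂)) * Real.sinh (u₄ - u₃))) :=
        mul_le_mul_of_nonneg_left k3 (by positivity)
    _ = _ := by rw [e1, ← e2]; ring

/-- The odd power map of exponent `β + 1`. -/
def signedPow (β t : ℝ) : ℝ := t * |t| ^ β

theorem signedPow_neg (β t : ℝ) : signedPow β (-t) = -signedPow β t := by
  simp [signedPow]

theorem signedPow_of_pos {β t : ℝ} (ht : 0 < t) : signedPow β t = t ^ (β + 1) := by
  rw [signedPow, abs_of_pos ht, Real.rpow_add_one ht.ne', mul_comm]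

theorem crossRatio_signedPow_le {β : ℝ} (hβ : 0 ≤ β) {a b c d : ℝ} (h : 0 < a ∨ d < 0)
    (hab : a < b) (hbc : b < c) (hcd : c < d) :
    crossRatio (signedPow β a) (signedPow β b) (signedPow β c) (signedPow β d) ≤
      crossRatio a b c d := by
  have key : ∀ {a b c d : ℝ}, 0 < a → a < b → b < c → c < d →
      crossRatio (signedPow β a) (signedPow β b) (signedPow β c) (signedPow β d) ≤
      crossRatio a b c d := by
    intro a b c d ha hab hbc hcd
    rw [signedPow_of_pos ha, signedPow_of_pos (by linarith), signedPow_of_pos (by linarith),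
      signedPow_of_pos (by linarith)]
    exact crossRatio_rpow_le (by linarith) ha hab hbc hcd
  rcases h with ha | hd
  · exact key ha hab hbc hcd
  · have := key (neg_pos.2 hd) (neg_lt_neg hcd) (neg_lt_neg hbc) (neg_lt_neg hab)
    simpa only [signedPow_neg, crossRatio_neg_reverse] using this

theorem signedPow_sub_le {β m u v : ℝ} (hβ : 0 ≤ β) (huv : u < v) (hu : |u| ≤ m) (hv : |v| ≤ m) :
    signedPow β v - signedPow β u ≤ (β + 1) * m ^ β * (v - u) := by
  have pos : ∀ {u v : ℝ}, 0 ≤ u → u < v → v ≤ m →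
      signedPow β v - signedPow β u ≤ (β + 1) * m ^ β * (v - u) := by
    intro u v hu huv hv
    have hv0 : 0 < v := hu.trans_lt huv
    have hbern : v ^ (β + 1) * (1 + (β + 1) * (u / v - 1)) ≤ u * u ^ β := by
      have h1 := one_add_mul_self_le_rpow_one_add (s := u / v - 1)
        (by linarith [div_nonneg hu hv0.le]) (show 1 ≤ β + 1 by linarith)
      rw [add_sub_cancel, Real.div_rpow hu hv0.le, le_div_iff₀ (by positivity)] at h1
      rcases hu.eq_or_lt with rfl | hu
      · rw [Real.zero_rpow (by linarith)] at h1
        linarith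
      · rw [Real.rpow_add_one hu.ne'] at h1
        linarith
    rw [signedPow, signedPow, abs_of_pos hv0, abs_of_nonneg hu]
    have h2 : v ^ (β + 1) * (1 + (β + 1) * (u / v - 1)) =
        v * v ^ β - (β + 1) * v ^ β * (v - u) := by
      rw [Real.rpow_add_one hv0.ne']; field_simp; ring
    have h3 : (β + 1) * v ^ β * (v - u) ≤ (β + 1) * m ^ β * (v - u) := by
      refine mul_le_mul_of_nonneg_right ?_ (by linarith)
      exact mul_le_mul_of_nonneg_left (Real.rpow_le_rpow hv0.le hv hβ) (by linarith)
    linarith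
  rcases le_or_gt 0 u with h0 | h0
  · exact pos h0 huv ((le_abs_self v).trans hv)
  rcases le_or_gt v 0 with h1 | h1
  · have := pos (neg_nonneg.2 h1) (neg_lt_neg huv) ((neg_le_abs u).trans hu)
    rw [signedPow_neg, signedPow_neg] at this
    linarith
  · have e1 := Real.rpow_le_rpow (abs_nonneg u) hu hβ
    have e2 := Real.rpow_le_rpow (abs_nonneg v) hv hβ
    have e3 : 0 ≤ m ^ β := Real.rpow_nonneg ((abs_nonneg u).trans hu) β
    unfold signedPow
    have e4 := mul_le_mul_of_nonneg_left e1 (neg_nonneg.2 h0.le)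
    have e5 := mul_le_mul_of_nonneg_left e2 h1.le
    have e6 : 0 ≤ β * m ^ β * (v - u) := by
      have : 0 ≤ v - u := by linarith
      positivity
    linarith

theorem le_signedPow_sub {β s t : ℝ} (hβ : 0 ≤ β) (hst : s < t) :
    max |s| |t| ^ β * (t - s) ≤ 2 * (signedPow β t - signedPow β s) := by
  have key : ∀ {s t : ℝ}, s < t → |s| ≤ |t| →
      |t| ^ β * (t - s) ≤ 2 * (signedPow β t - signedPow β s) := by
    intro s t hst hle
    have ht : 0 < t := by
      by_contra! h
      rw [abs_of_nonpos h, abs_of_neg (by linarith)] at hle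
      linarith
    have e1 := Real.rpow_le_rpow (abs_nonneg s) hle hβ
    have e2 : 0 ≤ |s| ^ β := Real.rpow_nonneg (abs_nonneg s) β
    have e3 : -t ≤ s := by
      rw [abs_of_pos ht] at hle
      exact (abs_le.1 hle).1
    unfold signedPow
    rcases le_or_gt 0 s with h0 | h0
    · have e4 := mul_le_mul_of_nonneg_left e1 h0
      have e5 := mul_nonneg (sub_nonneg.2 hst.le) (e2.trans e1)
      linarith
    · have e4 := mul_nonneg (neg_nonneg.2 h0.le) e2
      have e5 := mul_nonneg (show 0 ≤ t + s by linarith) (e2.trans e1)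
      linarith
  rcases le_total |s| |t| with h | h
  · rw [max_eq_right h]; exact key hst h
  · rw [max_eq_left h]
    have := key (neg_lt_neg hst) (by simpa using h)
    rw [signedPow_neg, signedPow_neg, abs_neg] at this
    linarith

theorem signedPow_slope_le {β s u v t : ℝ} (hβ : 0 ≤ β) (hsu : s ≤ u) (huv : u < v)
    (hvt : v ≤ t) :
    (signedPow β v - signedPow β u) / (v - u) ≤
      2 * (β + 1) * ((signedPow β t - signedPow β s) / (t - s)) := by
  have hu : |u| ≤ max |s| |t| := abs_le_max_abs_abs hsu (huv.le.trans hvt)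
  have hv : |v| ≤ max |s| |t| := abs_le_max_abs_abs (hsu.trans huv.le) hvt
  have h1 := signedPow_sub_le hβ huv hu hv
  have h2 := le_signedPow_sub hβ (show s < t by linarith)
  have h3 : max |s| |t| ^ β ≤ 2 * (signedPow β t - signedPow β s) / (t - s) :=
    (le_div_iff₀ (by linarith)).2 h2
  rw [div_le_iff₀ (by linarith)]
  refine h1.trans (mul_le_mul_of_nonneg_right ?_ (by linarith))
  calc (β + 1) * max |s| |t| ^ β ≤ (β + 1) * (2 * (signedPow β t - signedPow β s) / (t - s)) :=
        mul_le_mul_of_nonneg_left h3 (by linarith)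
    _ = _ := by ring

end Distortion

section LocalControl

theorem ContDiffAt.exists_slope_le_exp_mul_slope {g : ℝ → ℝ} {p : ℝ} (hg : ContDiffAt ℝ 2 g p)
    (hpos : 0 < deriv g p) :
    ∃ ε > 0, ∃ A m M : ℝ, 0 ≤ A ∧ 0 < m ∧ 0 < M ∧
      (∀ u v, p - ε < u → u < v → v < p + ε →
        m ≤ (g v - g u) / (v - u) ∧ (g v - g u) / (v - u) ≤ M) ∧
      ∀ a u v s t d, p - ε < a → a ≤ u → u < v → v ≤ d → a ≤ s → s < t → t ≤ d → d < p + ε →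
        (g v - g u) / (v - u) ≤ Real.exp (A * (d - a)) * ((g t - g s) / (t - s)) := by
  have h1 : ContDiffAt ℝ 1 (deriv g) p :=
    (hg.fderiv_right (m := 1) (by norm_num)).clm_apply (contDiffAt_const (c := (1 : ℝ)))
  obtain ⟨K, T, hT, hK⟩ := h1.exists_lipschitzOnWith
  have hlow := h1.continuousAt.eventually_const_lt (half_lt_self hpos)
  have hupp := h1.continuousAt.eventually_lt_const (show deriv g p < 2 * deriv g p by linarith)
  have hdiff : ∀ᶠ y in 𝓝 p, DifferentiableAt ℝ g y :=
    (hg.eventually (by simp)).mono fun y hy => hy.differentiableAt (by simp)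
  obtain ⟨ε, hε, hball⟩ := Metric.eventually_nhds_iff.1
    ((hlow.and hupp).and (hdiff.and (Filter.eventually_mem_set.2 hT)))
  set m := deriv g p / 2
  have hm : 0 < m := half_pos hpos
  have hb : ∀ y, p - ε < y → y < p + ε → m < deriv g y ∧ deriv g y < 2 * deriv g p ∧
      DifferentiableAt ℝ g y ∧ y ∈ T := fun y hy hy' => by
    have := hball (y := y) (by rw [Real.dist_eq, abs_lt]; constructor <;> linarith)
    tauto
  have mvt : ∀ u v, p - ε < u → u < v → v < p + ε →
      ∃ z, u < z ∧ z < v ∧ deriv g z = (g v - g u) / (v - u) := fun u v hu huv hv => by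
    obtain ⟨z, hz, hz'⟩ := exists_deriv_eq_slope g huv
      (fun y hy => (hb y (hu.trans_le hy.1) (hy.2.trans_lt hv)).2.2.1.continuousAt.continuousWithinAt)
      (fun y hy => (hb y (hu.trans hy.1) (hy.2.trans hv)).2.2.1.differentiableWithinAt)
    exact ⟨z, hz.1, hz.2, hz'⟩
  refine ⟨ε, hε, K / m, m, 2 * deriv g p, by positivity, hm, by linarith, ?_, ?_⟩
  · intro u v hu huv hv
    obtain ⟨z, hz, hz', e⟩ := mvt u v hu huv hv
    have := hb z (hu.trans hz) (hz'.trans hv)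
    rw [← e]
    exact ⟨this.1.le, this.2.1.le⟩
  · intro a u v s t d ha hau huv hvd has hst htd hd
    obtain ⟨z, hz, hz', e⟩ := mvt u v (ha.trans_le hau) huv (hvd.trans_lt hd)
    obtain ⟨w, hw, hw', e'⟩ := mvt s t (ha.trans_le has) hst (htd.trans_lt hd)
    rw [← e, ← e']
    have bz := hb z (by linarith) (by linarith)
    have bw := hb w (by linarith) (by linarith)
    have hd' : deriv g z - deriv g w ≤ K * (d - a) := by
      have h2 := hK.dist_le_mul z bz.2.2.2 w bw.2.2.2
      rw [Real.dist_eq, Real.dist_eq] at h2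
      refine (le_abs_self _).trans (h2.trans ?_)
      gcongr
      rw [abs_le]
      constructor <;> linarith
    have hx : (0 : ℝ) ≤ K / m * (d - a) := by
      have : 0 ≤ d - a := by linarith
      positivity
    have hle : m * (K / m * (d - a)) ≤ deriv g w * (K / m * (d - a)) :=
      mul_le_mul_of_nonneg_right bw.1.le hx
    have hmm : m * (K / m * (d - a)) = K * (d - a) := by field_simp
    calc deriv g z ≤ (K / m * (d - a) + 1) * deriv g w := by linarith
      _ ≤ _ := mul_le_mul_of_nonneg_right (Real.add_one_le_exp _) (hm.trans bw.1).le

/-- Control of the distortion of `f` on the ball of radius `δ` around `p`: difference quotients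
over an interval are bounded by those over a larger one, and cross-ratios of configurations free
of critical points increase by a factor exponential in the length at most. -/
structure LocalControl (f : ℝ → ℝ) (δ K p : ℝ) : Prop where
  slope_le : ∀ s u v t, p - δ < s → s ≤ u → u < v → v ≤ t → t < p + δ →
    (f v - f u) / (v - u) ≤ K * ((f t - f s) / (t - s))
  crossRatio_le : ∀ a b c d, p - δ < a → a < b → b < c → c < d → d < p + δ →
    (∀ z ∈ Icc a d, deriv f z ≠ 0) →
    crossRatio (f a) (f b) (f c) (f d) ≤ Real.exp (K * (d - a)) * crossRatio a b c d

theorem crossRatio_nonneg {a b c d : ℝ} (hab : a ≤ b) (hbc : b ≤ c) (hcd : c ≤ d) :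
    0 ≤ crossRatio a b c d := by
  unfold crossRatio
  exact div_nonneg (mul_nonneg (by linarith) (by linarith))
    (mul_nonneg (by linarith) (by linarith))

theorem StrictMono.slope_nonneg {f : ℝ → ℝ} (hf : StrictMono f) {s t : ℝ} (hst : s < t) :
    0 ≤ (f t - f s) / (t - s) :=
  div_nonneg (sub_nonneg.2 (hf hst).le) (sub_nonneg.2 hst.le)

theorem LocalControl.mono {f : ℝ → ℝ} {δ δ' K K' p : ℝ} (h : LocalControl f δ K p)
    (hf : StrictMono f) (hδ : δ' ≤ δ) (hK : K ≤ K') : LocalControl f δ' K' p where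
  slope_le s u v t hs hsu huv hvt ht :=
    (h.slope_le s u v t (by linarith) hsu huv hvt (by linarith)).trans
      (mul_le_mul_of_nonneg_right hK (hf.slope_nonneg (by linarith)))
  crossRatio_le a b c d ha hab hbc hcd hd hz := by
    refine (h.crossRatio_le a b c d (by linarith) hab hbc hcd (by linarith) hz).trans ?_
    refine mul_le_mul_of_nonneg_right ?_ (crossRatio_nonneg hab.le hbc.le hcd.le)
    exact Real.exp_le_exp.2 (mul_le_mul_of_nonneg_right hK (by linarith))

theorem LocalControl.of_dist_le {f : ℝ → ℝ} {δ δ' K p p' : ℝ} (h : LocalControl f δ K p)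
    (hp : |p' - p| + δ' ≤ δ) : LocalControl f δ' K p' where
  slope_le s u v t hs hsu huv hvt ht := by
    have := neg_le_abs (p' - p)
    have := le_abs_self (p' - p)
    exact h.slope_le s u v t (by linarith) hsu huv hvt (by linarith)
  crossRatio_le a b c d ha hab hbc hcd hd hz := by
    have := neg_le_abs (p' - p)
    have := le_abs_self (p' - p)
    exact h.crossRatio_le a b c d (by linarith) hab hbc hcd (by linarith) hz

theorem crossRatio_add_right (a b c d k : ℝ) :
    crossRatio (a + k) (b + k) (c + k) (d + k) = crossRatio a b c d := by
  simp [crossRatio]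

theorem LocalControl.add_intCast {f : ℝ → ℝ} {δ K p : ℝ} (h : LocalControl f δ K p)
    (hper : ∀ x, f (x + 1) = f x + 1) (k : ℤ) : LocalControl f δ K (p + k) := by
  have hk : ∀ x, f x = f (x - k) + k := fun x => by
    have := iterate_map_add_intCast hper 1 (x - k) k
    simpa using this
  constructor
  · intro s u v t hs hsu huv hvt ht
    have := h.slope_le (s - k) (u - k) (v - k) (t - k) (by linarith) (by linarith) (by linarith)
      (by linarith) (by linarith)
    rw [hk s, hk u, hk v, hk t]
    simpa using this
  · intro a b c d ha hab hbc hcd hd hz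
    have := h.crossRatio_le (a - k) (b - k) (c - k) (d - k) (by linarith) (by linarith)
      (by linarith) (by linarith) (by linarith) (fun z hz' => by
        have h1 := hz (z + k) ⟨by linarith [hz'.1], by linarith [hz'.2]⟩
        have h2 : f = fun x => f (x - k) + k := funext hk
        rw [h2, deriv_add_const, deriv_comp_sub_const] at h1
        simpa using h1)
    rw [hk a, hk b, hk c, hk d, crossRatio_add_right]
    have e := crossRatio_add_right (a - k) (b - k) (c - k) (d - k) k
    simp only [sub_add_cancel] at e
    rw [e]
    simpa using this

theorem crossRatio_le_of_slope_le {f : ℝ → ℝ} (hf : StrictMono f) {E a b c d : ℝ}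
    (hab : a < b) (hbc : b < c) (hcd : c < d)
    (h1 : (f b - f a) / (b - a) ≤ E * ((f c - f a) / (c - a)))
    (h2 : (f d - f c) / (d - c) ≤ E * ((f d - f b) / (d - b))) :
    crossRatio (f a) (f b) (f c) (f d) ≤ E * E * crossRatio a b c d := by
  refine crossRatio_le_mul_of_slope_le hab hbc hcd (hf hab) (hf hbc) (hf hcd) ?_
  calc _ ≤ E * ((f c - f a) / (c - a)) * (E * ((f d - f b) / (d - b))) :=
        mul_le_mul h1 h2 (hf.slope_nonneg hcd) ((hf.slope_nonneg hab).trans h1)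
    _ = _ := by ring

theorem exists_localControl_of_deriv_pos {f : ℝ → ℝ} {p : ℝ} (hf : StrictMono f)
    (hg : ContDiffAt ℝ 2 f p) (hpos : 0 < deriv f p) : ∃ δ > 0, ∃ K, LocalControl f δ K p := by
  obtain ⟨ε, hε, A, m, M, hA, hm, hM, hmM, hE⟩ := hg.exists_slope_le_exp_mul_slope hpos
  refine ⟨ε, hε, max (M / m) (2 * A), ?_, ?_⟩
  · intro s u v t hs hsu huv hvt ht
    have h1 := (hmM u v (by linarith) huv (by linarith)).2
    have h2 := (hmM s t hs (by linarith) ht).1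
    calc _ ≤ M / m * m := by rwa [div_mul_cancel₀ _ hm.ne']
      _ ≤ max (M / m) (2 * A) * m := mul_le_mul_of_nonneg_right (le_max_left _ _) hm.le
      _ ≤ _ := mul_le_mul_of_nonneg_left h2 ((by positivity : 0 ≤ M / m).trans (le_max_left _ _))
  · intro a b c d ha hab hbc hcd hd _
    have := crossRatio_le_of_slope_le hf hab hbc hcd
      (hE a a b a c d ha le_rfl hab (by linarith) le_rfl (by linarith) (by linarith) hd)
      (hE a c d b d d ha (by linarith) hcd le_rfl (by linarith) (by linarith) le_rfl hd)
    rw [← Real.exp_add] at this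
    refine this.trans (mul_le_mul_of_nonneg_right ?_ (crossRatio_nonneg hab.le hbc.le hcd.le))
    refine Real.exp_le_exp.2 ?_
    have := mul_le_mul_of_nonneg_right (le_max_right (M / m) (2 * A)) (show 0 ≤ d - a by linarith)
    linarith

theorem signedPow_nonpos {β t : ℝ} (ht : t ≤ 0) : signedPow β t ≤ 0 :=
  mul_nonpos_of_nonpos_of_nonneg ht (Real.rpow_nonneg (abs_nonneg t) β)

/-- The coordinate of a power-law critical point of an increasing map is increasing. -/
theorem deriv_pos_of_signedPow {f φ : ℝ → ℝ} {W : Set ℝ} {β c : ℝ} (hf : StrictMono f)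
    (hW : W ∈ 𝓝 c) (hφ : ContDiffAt ℝ 2 φ c) (h0 : φ c = 0) (hd : deriv φ c ≠ 0)
    (h : ∀ x ∈ W, f x = f c + signedPow β (φ x)) : 0 < deriv φ c := by
  by_contra! hneg
  have hpos : 0 < deriv (fun x => -φ x) c := by
    rw [deriv.fun_neg]
    exact neg_pos.2 (lt_of_le_of_ne hneg hd)
  obtain ⟨ε, hε, A, m, M, -, hm, -, hmM, -⟩ := hφ.neg.exists_slope_le_exp_mul_slope hpos
  obtain ⟨η, hη, hball⟩ := Metric.mem_nhds_iff.1 hW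
  set v := c + min ε η / 2 with hv
  have hmin : 0 < min ε η := lt_min hε hη
  have hlt : c < v := by linarith
  have h1 := (hmM c v (by linarith) hlt (by linarith [min_le_left ε η])).1
  rw [le_div_iff₀ (by linarith)] at h1
  have h2 : φ v ≤ 0 := by
    have := mul_pos hm (sub_pos.2 hlt)
    simp only [h0] at h1
    linarith
  have h3 := h v (hball (by
    rw [Metric.mem_ball, Real.dist_eq, hv, add_sub_cancel_left, abs_of_pos (by linarith)]
    linarith [min_le_right ε η]))
  have h4 := hf hlt
  have := signedPow_nonpos (β := β) h2
  linarith

theorem exists_localControl_of_signedPow {f φ : ℝ → ℝ} {W : Set ℝ} {β c : ℝ} (hf : StrictMono f)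
    (hβ : 0 ≤ β) (hW : W ∈ 𝓝 c) (hφ : ContDiffAt ℝ 2 φ c) (h0 : φ c = 0) (hd : deriv φ c ≠ 0)
    (hc : deriv f c = 0) (h : ∀ x ∈ W, f x = f c + signedPow β (φ x)) :
    ∃ δ > 0, ∃ K, LocalControl f δ K c := by
  have hpos := deriv_pos_of_signedPow hf hW hφ h0 hd h
  obtain ⟨ε, hε, A, m, M, hA, hm, hM, hmM, hE⟩ := hφ.exists_slope_le_exp_mul_slope hpos
  obtain ⟨η, hη, hball⟩ := Metric.mem_nhds_iff.1 hW
  have hfx : ∀ x, c - min ε η < x → x < c + min ε η → f x = f c + signedPow β (φ x) :=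
    fun x hx hx' => h x (hball (by
      rw [Metric.mem_ball, Real.dist_eq, abs_lt]
      constructor <;> linarith [min_le_right ε η]))
  have hmono : ∀ u v, c - min ε η < u → u < v → v < c + min ε η → φ u < φ v := by
    intro u v hu huv hv
    have h1 := (hmM u v (by linarith [min_le_left ε η]) huv (by linarith [min_le_left ε η])).1
    rw [le_div_iff₀ (by linarith)] at h1
    have := mul_pos hm (sub_pos.2 huv)
    linarith
  refine ⟨min ε η, lt_min hε hη, max (2 * (β + 1) * (M / m)) (2 * A), ?_, ?_⟩
  · intro s u v t hs hsu huv hvt ht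
    refine le_trans ?_ (mul_le_mul_of_nonneg_right (le_max_left _ _)
      (hf.slope_nonneg (by linarith)))
    have mono_le : ∀ x y, c - min ε η < x → x ≤ y → y < c + min ε η → φ x ≤ φ y :=
      fun x y hx hxy hy => by
        rcases hxy.eq_or_lt with rfl | hxy
        · exact le_rfl
        · exact (hmono x y hx hxy hy).le
    have hφuv := hmono u v (by linarith) huv (by linarith)
    have hφst := hmono s t hs (by linarith) ht
    have h1 := signedPow_slope_le hβ (mono_le s u hs hsu (by linarith)) hφuv
      (mono_le v t (by linarith) hvt ht)
    have h2 := (hmM u v (by linarith [min_le_left ε η]) huv (by linarith [min_le_left ε η])).2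
    have h3 := (hmM s t (by linarith [min_le_left ε η]) (by linarith)
      (by linarith [min_le_left ε η])).1
    have hF : ∀ x y, c - min ε η < x → x < y → y < c + min ε η → (f y - f x) / (y - x) =
        (signedPow β (φ y) - signedPow β (φ x)) / (φ y - φ x) * ((φ y - φ x) / (y - x)) := by
      intro x y hx hxy hy
      have := (sub_pos.2 (hmono x y hx hxy hy)).ne'
      have := (sub_pos.2 hxy).ne'
      rw [hfx x hx (by linarith), hfx y (by linarith) hy, add_sub_add_left_eq_sub]
      field_simp
    have hmonoP : ∀ x y, c - min ε η < x → x < y → y < c + min ε η →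
        0 ≤ (signedPow β (φ y) - signedPow β (φ x)) / (φ y - φ x) := by
      intro x y hx hxy hy
      have h4 := hf hxy
      rw [hfx x hx (by linarith), hfx y (by linarith) hy] at h4
      exact div_nonneg (by linarith) (by linarith [hmono x y hx hxy hy])
    rw [hF u v (by linarith) huv (by linarith), hF s t hs (by linarith) ht]
    set P := (signedPow β (φ t) - signedPow β (φ s)) / (φ t - φ s)
    have hP : 0 ≤ P := hmonoP s t hs (by linarith) ht
    calc _ ≤ 2 * (β + 1) * P * M :=
          mul_le_mul h1 h2 (div_nonneg (by linarith) (by linarith)) (by positivity)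
      _ = 2 * (β + 1) * (M / m) * (P * m) := by field_simp
      _ ≤ _ := by gcongr
  · intro a b c' d ha hab hbc hcd hd hz
    have hφab := hmono a b ha hab (by linarith)
    have hφbc := hmono b c' (by linarith) hbc (by linarith)
    have hφcd := hmono c' d (by linarith) hcd hd
    have hside : 0 < φ a ∨ φ d < 0 := by
      rcases lt_or_ge c a with h1 | h1
      · left; rw [← h0]; exact hmono c a (by linarith) h1 (by linarith)
      rcases lt_or_ge d c with h2 | h2
      · right; rw [← h0]; exact hmono d c (by linarith) h2 (by linarith)
      exact absurd hc (hz c ⟨h1, h2⟩)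
    have h1 := crossRatio_signedPow_le hβ hside hφab hφbc hφcd
    have e : crossRatio (f a) (f b) (f c') (f d) = crossRatio (signedPow β (φ a))
        (signedPow β (φ b)) (signedPow β (φ c')) (signedPow β (φ d)) := by
      rw [hfx a ha (by linarith), hfx b (by linarith) (by linarith),
        hfx c' (by linarith) (by linarith), hfx d (by linarith) hd]
      simp [crossRatio]
    rw [e]
    refine h1.trans ?_
    have hl := min_le_left ε η
    have s1 := hE a a b a c' d (by linarith) le_rfl hab (by linarith) le_rfl (by linarith)
      (by linarith) (by linarith)
    have s2 := hE a c' d b d d (by linarith) (by linarith) hcd le_rfl (by linarith) (by linarith)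
      le_rfl (by linarith)
    have h2 := crossRatio_le_mul_of_slope_le
      (E := Real.exp (A * (d - a)) * Real.exp (A * (d - a))) hab hbc hcd hφab hφbc hφcd (by
        calc _ ≤ _ := mul_le_mul s1 s2 (div_nonneg (by linarith) (by linarith))
              (mul_nonneg (Real.exp_pos _).le (div_nonneg (by linarith) (by linarith)))
          _ = _ := by ring)
    refine h2.trans (mul_le_mul_of_nonneg_right ?_ (crossRatio_nonneg hab.le hbc.le hcd.le))
    rw [← Real.exp_add]
    refine Real.exp_le_exp.2 ?_
    have := mul_le_mul_of_nonneg_right (le_max_right (2 * (β + 1) * (M / m)) (2 * A))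
      (show 0 ≤ d - a by linarith)
    linarith

end LocalControl

section GlobalControl

variable {f : ℝ → ℝ}

theorem exists_uniform_localControl (hf : StrictMono f) (hper : ∀ x, f (x + 1) = f x + 1)
    (hloc : ∀ p, ∃ δ > 0, ∃ K, LocalControl f δ K p) :
    ∃ δ > 0, ∃ K, ∀ p, LocalControl f δ K p := by
  have hcpt : ∃ δ > 0, ∃ K, ∀ p ∈ Icc (0 : ℝ) 1, LocalControl f δ K p := by
    refine isCompact_Icc.induction_on (p := fun S => ∃ δ > 0, ∃ K, ∀ p ∈ S, LocalControl f δ K p)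
      ⟨1, one_pos, 0, by simp⟩ ?_ ?_ ?_
    · rintro S T hST ⟨δ, hδ, K, h⟩
      exact ⟨δ, hδ, K, fun p hp => h p (hST hp)⟩
    · rintro S T ⟨δ, hδ, K, h⟩ ⟨δ', hδ', K', h'⟩
      refine ⟨min δ δ', lt_min hδ hδ', max K K', ?_⟩
      rintro p (hp | hp)
      · exact (h p hp).mono hf (min_le_left _ _) (le_max_left _ _)
      · exact (h' p hp).mono hf (min_le_right _ _) (le_max_right _ _)
    · intro p _
      obtain ⟨δ, hδ, K, h⟩ := hloc p
      refine ⟨Metric.ball p (δ / 2), mem_nhdsWithin_of_mem_nhds (Metric.ball_mem_nhds p (half_pos hδ)),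
        δ / 2, half_pos hδ, K, fun q hq => h.of_dist_le ?_⟩
      rw [Metric.mem_ball, Real.dist_eq] at hq
      linarith
  obtain ⟨δ, hδ, K, h⟩ := hcpt
  refine ⟨δ, hδ, K, fun p => ?_⟩
  have := (h (Int.fract p) ⟨Int.fract_nonneg p, (Int.fract_lt_one p).le⟩).add_intCast hper ⌊p⌋
  rwa [Int.fract_add_floor] at this

theorem exists_mul_le_sub_of_le (hf : StrictMono f) (hcont : Continuous f)
    (hper : ∀ x, f (x + 1) = f x + 1) {δ : ℝ} (hδ : 0 < δ) :
    ∃ κ > 0, ∀ s t, δ ≤ t - s → κ * (t - s) ≤ f t - f s := by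
  obtain ⟨y, -, hy⟩ := (isCompact_Icc (a := (0 : ℝ)) (b := 1)).exists_isMinOn ⟨0, by simp⟩
    (f := fun x => f (x + δ) - f x) (by fun_prop)
  set η := f (y + δ) - f y
  have hη : 0 < η := sub_pos.2 (hf (by linarith))
  have hstep : ∀ x, f x + η ≤ f (x + δ) := fun x => by
    have h1 : η ≤ f (Int.fract x + δ) - f (Int.fract x) :=
      hy ⟨Int.fract_nonneg x, (Int.fract_lt_one x).le⟩
    have h2 := iterate_map_sub_intCast hper 1 (x + δ) ⌊x⌋
    have h3 := iterate_map_sub_intCast hper 1 x ⌊x⌋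
    simp only [Function.iterate_one] at h2 h3
    rw [Int.fract, h3, show x - ⌊x⌋ + δ = x + δ - ⌊x⌋ by ring, h2] at h1
    linarith
  have hiter : ∀ (n : ℕ) x, f x + n * η ≤ f (x + n * δ) := by
    intro n x
    induction n with
    | zero => simp
    | succ n ih =>
      have := hstep (x + n * δ)
      push_cast
      rw [show x + (n + 1) * δ = x + n * δ + δ by ring]
      linarith
  refine ⟨η / (2 * δ), by positivity, fun s t hst => ?_⟩
  set n := ⌊(t - s) / δ⌋₊
  have h0 : 0 ≤ (t - s) / δ := div_nonneg (by linarith) hδ.le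
  have h1 : (n : ℝ) * δ ≤ t - s := (le_div_iff₀ hδ).1 (Nat.floor_le h0)
  have h2 : t - s < (n + 1) * δ := (div_lt_iff₀ hδ).1 (Nat.lt_floor_add_one _)
  have h3 : (1 : ℝ) ≤ n := by
    exact_mod_cast Nat.le_floor (by simpa using (one_le_div hδ).2 hst)
  have h4 := hf.monotone (show s + n * δ ≤ t by linarith)
  have h5 : t - s ≤ 2 * n * δ := by nlinarith
  calc η / (2 * δ) * (t - s) ≤ η / (2 * δ) * (2 * n * δ) := by gcongr
    _ = n * η := by field_simp
    _ ≤ _ := by linarith [hiter n s]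

theorem exists_deriv_le (hf : ContDiff ℝ 1 f) (hper : ∀ x, f (x + 1) = f x + 1) :
    ∃ S, ∀ x, deriv f x ≤ S := by
  obtain ⟨S, hS⟩ := (isCompact_Icc (a := (0 : ℝ)) (b := 1)).exists_bound_of_continuousOn
    (hf.continuous_deriv le_rfl).continuousOn
  refine ⟨S, fun x => ?_⟩
  have h1 : f = fun y => f (y - ⌊x⌋) + ⌊x⌋ := funext fun y => by
    simpa using iterate_map_add_intCast hper 1 (y - ⌊x⌋) ⌊x⌋
  have h2 : deriv f x = deriv f (Int.fract x) := by
    conv_lhs => rw [h1]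
    rw [deriv_add_const, deriv_comp_sub_const, Int.fract]
  rw [h2]
  exact (le_abs_self _).trans (hS _ ⟨Int.fract_nonneg x, (Int.fract_lt_one x).le⟩)

theorem exists_slope_le_mul_slope (hf : StrictMono f) (hC : ContDiff ℝ 1 f)
    (hper : ∀ x, f (x + 1) = f x + 1) {δ K : ℝ} (hδ : 0 < δ) (hK : ∀ p, LocalControl f δ K p) :
    ∃ E, 1 ≤ E ∧ ∀ s u v t, s ≤ u → u < v → v ≤ t →
      (f v - f u) / (v - u) ≤ E * ((f t - f s) / (t - s)) := by
  obtain ⟨κ, hκ, hlow⟩ := exists_mul_le_sub_of_le hf hC.continuous hper hδ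
  obtain ⟨S, hS⟩ := exists_deriv_le hC hper
  refine ⟨max 1 (max K (S / κ)), le_max_left _ _, fun s u v t hsu huv hvt => ?_⟩
  have hst : s < t := by linarith
  rcases lt_or_ge (t - s) δ with h | h
  · exact ((hK s).slope_le s u v t (by linarith) hsu huv hvt (by linarith)).trans
      (mul_le_mul_of_nonneg_right ((le_max_left _ _).trans (le_max_right _ _))
        (hf.slope_nonneg hst))
  · have h1 : (f v - f u) / (v - u) ≤ S := by
      rw [div_le_iff₀ (by linarith)]
      exact image_sub_le_mul_sub_of_deriv_le (hC.differentiable one_ne_zero) hS huv.le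
    have h2 : κ ≤ (f t - f s) / (t - s) := (le_div_iff₀ (by linarith)).2 (hlow s t h)
    have h3 : 0 ≤ S := (hf.slope_nonneg huv).trans h1
    calc _ ≤ S / κ * κ := by rwa [div_mul_cancel₀ _ hκ.ne']
      _ ≤ S / κ * ((f t - f s) / (t - s)) := by gcongr
      _ ≤ _ := mul_le_mul_of_nonneg_right ((le_max_right _ _).trans (le_max_right _ _))
        (hf.slope_nonneg hst)

theorem floor_add_ceil_le {x y : ℝ} (hxy : x ≤ y) : (⌊x⌋ : ℝ) + ⌈x⌉ ≤ ⌊y⌋ + ⌈y⌉ := by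
  have h1 := Int.floor_le_floor hxy
  have h2 := Int.ceil_le_ceil hxy
  exact_mod_cast add_le_add h1 h2

theorem floor_add_ceil_add_one_le {x y : ℝ} (hxy : x < y) {k : ℤ} (hx : x ≤ k) (hy : k ≤ y) :
    (⌊x⌋ : ℝ) + ⌈x⌉ + 1 ≤ ⌊y⌋ + ⌈y⌉ := by
  have h1 := Int.floor_le_floor hxy.le
  have h2 := Int.ceil_le_ceil hxy.le
  have h3 : k ≤ ⌊y⌋ := Int.le_floor.2 hy
  have h4 : ⌈x⌉ ≤ k := Int.ceil_le.2 hx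
  have h5 : ⌊x⌋ < k ∨ k < ⌈y⌉ := by
    rcases hx.lt_or_eq with h | h
    · exact Or.inl (Int.floor_lt.2 h)
    · exact Or.inr (Int.lt_ceil.2 (h ▸ hxy))
  have : ⌊x⌋ + ⌈x⌉ + 1 ≤ ⌊y⌋ + ⌈y⌉ := by omega
  exact_mod_cast this

theorem exists_crossRatioControl (hf : StrictMono f) (hC : ContDiff ℝ 1 f)
    (hper : ∀ x, f (x + 1) = f x + 1) (C : Finset ℝ)
    (hzero : ∀ x, deriv f x = 0 → ∃ c ∈ C, ∃ k : ℤ, x = c + k)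
    (hloc : ∀ p, ∃ δ > 0, ∃ K, LocalControl f δ K p) :
    ∃ (h : ℝ → ℝ) (D : ℝ), CrossRatioControl f h ∧ Monotone h ∧ ∀ x, h (x + 1) = h x + D := by
  obtain ⟨δ, hδ, K, hK⟩ := exists_uniform_localControl hf hper hloc
  obtain ⟨E, hE1, hE⟩ := exists_slope_le_mul_slope hf hC hper hδ hK
  set L := Real.log (E * E) with hL
  have hL0 : 0 ≤ L := Real.log_nonneg (by nlinarith)
  set B := max K 0 + L / δ
  have hB : 0 ≤ B := add_nonneg (le_max_right _ _) (div_nonneg hL0 hδ.le)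
  set G : ℝ → ℝ := fun x => ∑ c ∈ C, ((⌊x - c⌋ : ℝ) + ⌈x - c⌉)
  have hG : Monotone G := fun x y hxy =>
    Finset.sum_le_sum fun c _ => floor_add_ceil_le (sub_le_sub_right hxy c)
  refine ⟨fun x => B * x + L * G x, B + L * (C.card * 2), ?_, ?_, ?_⟩
  · intro a b c d hab hbc hcd
    have had : 0 ≤ d - a := by linarith
    have hGad := mul_le_mul_of_nonneg_left (hG (show a ≤ d by linarith)) hL0
    have hBad : L / δ * (d - a) ≤ B * (d - a) :=
      mul_le_mul_of_nonneg_right (le_add_of_nonneg_left (le_max_right _ _)) had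
    have far : L ≤ B * d + L * G d - (B * a + L * G a) →
        crossRatio (f a) (f b) (f c) (f d) ≤
          Real.exp (B * d + L * G d - (B * a + L * G a)) * crossRatio a b c d := by
      intro hle
      refine (crossRatio_le_of_slope_le hf hab hbc hcd (hE a a b c le_rfl hab hbc.le)
        (hE b c d d hbc.le hcd le_rfl)).trans ?_
      refine mul_le_mul_of_nonneg_right ?_ (crossRatio_nonneg hab.le hbc.le hcd.le)
      rw [← Real.exp_log (show 0 < E * E by nlinarith)]
      exact Real.exp_le_exp.2 hle
    by_cases hz : ∀ z ∈ Icc a d, deriv f z ≠ 0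
    · rcases lt_or_ge (d - a) δ with h1 | h1
      · refine ((hK a).crossRatio_le a b c d (by linarith) hab hbc hcd (by linarith) hz).trans
          (mul_le_mul_of_nonneg_right ?_ (crossRatio_nonneg hab.le hbc.le hcd.le))
        refine Real.exp_le_exp.2 ?_
        have h2 : K * (d - a) ≤ B * (d - a) := mul_le_mul_of_nonneg_right
          ((le_max_left K 0).trans (le_add_of_nonneg_right (div_nonneg hL0 hδ.le))) had
        linarith
      · refine far ?_
        have h2 : L / δ * δ ≤ L / δ * (d - a) :=
          mul_le_mul_of_nonneg_left h1 (div_nonneg hL0 hδ.le)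
        rw [div_mul_cancel₀ _ hδ.ne'] at h2
        linarith
    · push Not at hz
      obtain ⟨z, hz, hz0⟩ := hz
      obtain ⟨e, he, k, rfl⟩ := hzero z hz0
      refine far ?_
      have h1 : G a + 1 ≤ G d := by
        have h2 : ∀ i ∈ C, 0 ≤ ((⌊d - i⌋ : ℝ) + ⌈d - i⌉) - (⌊a - i⌋ + ⌈a - i⌉) := fun i _ =>
          sub_nonneg.2 (floor_add_ceil_le (by linarith))
        have h3 := Finset.single_le_sum h2 he
        have h4 := floor_add_ceil_add_one_le (x := a - e) (y := d - e) (k := k) (by linarith)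
          (by linarith [hz.1]) (by linarith [hz.2])
        rw [Finset.sum_sub_distrib] at h3
        linarith
      have h2 := mul_le_mul_of_nonneg_left h1 hL0
      have h3 := mul_nonneg hB had
      linarith
  · intro x y hxy
    exact add_le_add (mul_le_mul_of_nonneg_left hxy hB) (mul_le_mul_of_nonneg_left (hG hxy) hL0)
  · intro x
    have : G (x + 1) = G x + C.card * 2 := by
      simp only [G]
      rw [← nsmul_eq_mul, ← Finset.sum_const, ← Finset.sum_add_distrib]
      refine Finset.sum_congr rfl fun c _ => ?_
      rw [add_sub_right_comm, Int.floor_add_one, Int.ceil_add_one]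
      push_cast
      ring
    simp only [this]
    ring

end GlobalControl

theorem MCircle.IsMulticriticalLift.exists_crossRatioControl {f : ℝ → ℝ} {C : Finset ℝ}
    {dc : ℝ → ℝ} (hf : IsMulticriticalLift f C dc) :
    ∃ (h : ℝ → ℝ) (D : ℝ), CrossRatioControl f h ∧ Monotone h ∧ ∀ x, h (x + 1) = h x + D := by
  obtain ⟨⟨hsm, hmono, hper⟩, -, -, hzero, hcrit⟩ := hf
  refine _root_.exists_crossRatioControl hmono (hsm.of_le (by norm_num)) hper C
    (fun x hx => (hzero x).1 hx) fun p => ?_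
  by_cases hp : deriv f p = 0
  · obtain ⟨c, hc, k, rfl⟩ := (hzero p).1 hp
    obtain ⟨hd, W, φ, hW, hcW, hφ, h0, hφd, -, hWf⟩ := hcrit c hc
    obtain ⟨δ, hδ, K, h⟩ := exists_localControl_of_signedPow hmono (sub_nonneg.2 hd.le)
      (hW.mem_nhds hcW) ((hφ.contDiffAt (hW.mem_nhds hcW)).of_le (by norm_num)) h0 (hφd c hcW)
      ((hzero c).2 ⟨c, hc, 0, by simp⟩) hWf
    exact ⟨δ, hδ, K, h.add_intCast hper k⟩
  · exact exists_localControl_of_deriv_pos hmono (hsm.contDiffAt.of_le (by norm_num))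
      (lt_of_le_of_ne hmono.monotone.deriv_nonneg (Ne.symm hp))

/-- **The `C¹` bounds** (Lemma 3.1). For a multicritical circle map `f` with irrational
rotation number and a fixed critical point `c₀` there are `K = K(f) > 1` and
`n₀ = n₀(f)` such that for all `n > n₀`, all `x ∈ Iₙ` and all `0 ≤ j ≤ q_{n+1}`,
`Df^j(x) ≤ K |f^j(Iₙ)| / |Iₙ|`. -/
theorem key_C1_bounds (f : ℝ → ℝ) (C : Finset ℝ) (dc : ℝ → ℝ) (ρ c₀ : ℝ)
    (hf : GoodMap f C dc ρ) (hc₀ : c₀ ∈ C) :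
    ∃ K : ℝ, 1 < K ∧ ∃ n₀ : ℕ, ∀ n > n₀, ∀ x ∈ arcI f ρ c₀ n, ∀ j ≤ qden ρ (n + 1),
      deriv (f^[j]) x ≤ K * (arcImgLen f ρ c₀ n j / arcLen f ρ c₀ n) := by
  obtain ⟨hL, hrot, hρ, hρ'⟩ := hf
  obtain ⟨h, D, hcr, hmono, hD⟩ := hL.exists_crossRatioControl
  obtain ⟨K, hK, hb⟩ := exists_deriv_iterate_le_of_hasRotNumber hcr hL.1.mono
    (hL.1.smooth.differentiable (by norm_num)) hL.1.periodic hmono hD hrot hρ hρ'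
  exact ⟨K, hK, 0, fun n _ => hb c₀ n⟩
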